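/- Fix r ∈ (0,1), α ∈ (0,∞), β > 0, and λ > 0, and consider a sequence n, d → ∞ with n/d² → α and k = ⌈r(n−1)⌉, with data from the Gaussian model. Let Ŵ be the (unique, by strong convexity in W) weight-matrix component of a global minimizer of the joint TAM objective Ψ. Then there exists a constant c₀ > 0, depending only on (α, r, β, λ), such that for every D > 0 there is d₀ = d₀(D) with P( ‖Ŵ‖_F/d ≥ c₀ ) ≥ 1 − d^{−D} for all d ≥ d₀. -/

import Mathlib

open MeasureTheory ProbabilityTheory Filter Topology Matrix

noncomputable section

/-- The law `N(0, I_d/d)` on `ℝ^d`. -/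
def stdGaussianVec (d : ℕ) : Measure (Fin d → ℝ) :=
  Measure.pi fun _ => gaussianReal 0 (d : NNReal)⁻¹

/-- The Gaussian model: `u_1, …, u_n, v_1, …, v_n` mutually independent `N(0, I_d/d)`. -/
def gaussianModel (d n : ℕ) :
    Measure ((Fin n → Fin d → ℝ) × (Fin n → Fin d → ℝ)) :=
  (Measure.pi fun _ : Fin n => stdGaussianVec d).prod
    (Measure.pi fun _ : Fin n => stdGaussianVec d)

/-- The logistic loss `ℓ(t) = log(1 + e^{-t})`. -/
def logisticLoss (t : ℝ) : ℝ := Real.log (1 + Real.exp (-t))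

/-- The softplus `φ_β(t) = β⁻¹ log(1 + e^{β t})`. -/
def softplus (β t : ℝ) : ℝ := Real.log (1 + Real.exp (β * t)) / β

/-- The joint TAM objective `Ψ(W,μ)`. -/
def tamObjective {d n : ℕ} (u v : Fin n → Fin d → ℝ) (k : ℕ) (β lam : ℝ)
    (W : Matrix (Fin d) (Fin d) ℝ) (μ : Fin n → ℝ) : ℝ :=
  (∑ i : Fin n, logisticLoss ((u i ⬝ᵥ W.mulVec (v i)) - μ i -
      (k : ℝ)⁻¹ * ∑ j ∈ Finset.univ.erase i,
        softplus β ((u j ⬝ᵥ W.mulVec (v i)) - μ i))) +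
    lam * n / (2 * (d : ℝ) ^ 2) * ∑ a, ∑ b, W a b ^ 2

lemma gauss_sq_mgf (s : NNReal) (hs : s ≠ 0) (t : ℝ) (ht : 2 * t * s < 1) :
    Integrable (fun x => Real.exp (t * x ^ 2)) (gaussianReal 0 s) ∧
    ∫ x, Real.exp (t * x ^ 2) ∂(gaussianReal 0 s) = Real.sqrt (1 / (1 - 2 * t * s)) := by
  have hs' : (0:ℝ) < s := lt_of_le_of_ne s.2 (by exact_mod_cast hs.symm)
  have hb : 0 < 1 / (2 * (s:ℝ)) - t := by
    rw [sub_pos, lt_div_iff₀ (by positivity)]; linarith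
  have key : ∀ x : ℝ, gaussianPDFReal 0 s x • Real.exp (t * x ^ 2)
      = (Real.sqrt (2 * Real.pi * s))⁻¹ * Real.exp (-(1 / (2 * (s:ℝ)) - t) * x ^ 2) := by
    intro x
    rw [gaussianPDFReal, smul_eq_mul, mul_assoc, ← Real.exp_add]
    congr 2
    field_simp
    ring
  constructor
  · rw [gaussianReal_of_var_ne_zero _ hs]
    rw [integrable_withDensity_iff_integrable_smul' (measurable_gaussianPDF 0 s)
      (ae_of_all _ fun x => gaussianPDF_lt_top)]
    simp only [toReal_gaussianPDF]
    simp_rw [key]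
    exact (integrable_exp_neg_mul_sq hb).const_mul _
  · rw [integral_gaussianReal_eq_integral_smul hs]
    simp_rw [key]
    rw [integral_const_mul, integral_gaussian, ← Real.sqrt_inv, ← Real.sqrt_mul (by positivity)]
    congr 1
    have : (1 - 2 * t * s) ≠ 0 := by linarith
    field_simp

lemma chi_upper {Ω : Type*} [MeasurableSpace Ω] (P : Measure Ω) [IsProbabilityMeasure P]
    {M : ℕ} (X : Fin M → Ω → ℝ) (hm : ∀ i, Measurable (X i)) (hi : iIndepFun X P)
    (s : Fin M → NNReal) (hl : ∀ i, P.map (X i) = gaussianReal 0 (s i))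
    (S : ℝ) (hS : 0 < S) (hsS : ∀ i, (s i : ℝ) ≤ S) (K : ℝ) :
    P {ω | K * M * S ≤ ∑ i, X i ω ^ 2} ≤ ENNReal.ofReal (Real.exp (-(M * (K / 4 - 1)))) := by
  set t : ℝ := 1 / (4 * S) with ht
  have htp : 0 < t := by positivity
  have h1 : ∀ i, Integrable (fun x => Real.exp (t * x ^ 2)) (gaussianReal 0 (s i)) ∧
      ∫ x, Real.exp (t * x ^ 2) ∂(gaussianReal 0 (s i)) ≤ Real.exp 1 := by
    intro i
    by_cases h0 : s i = 0
    · rw [h0, gaussianReal_zero_var]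
      refine ⟨?_, ?_⟩
      · exact integrable_dirac (by simp)
      · simp
    · have hts : 2 * t * s i ≤ 1 / 2 := by
        rw [ht]; have := hsS i
        rw [show 2 * (1 / (4 * S)) * (s i : ℝ) = (s i / S) / 2 by field_simp; norm_num]
        have : (s i : ℝ) / S ≤ 1 := by rw [div_le_one hS]; exact this
        linarith
      obtain ⟨a, b⟩ := gauss_sq_mgf (s i) h0 t (by linarith)
      refine ⟨a, ?_⟩
      rw [b]
      have : 1 / (1 - 2 * t * s i) ≤ 2 := by
        rw [div_le_iff₀ (by linarith)]; linarith
      calc _ ≤ Real.sqrt 4 := Real.sqrt_le_sqrt (by linarith)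
        _ = 2 := by rw [show (4:ℝ) = 2 ^ 2 by norm_num]; exact Real.sqrt_sq (by norm_num)
        _ ≤ _ := by have := Real.add_one_le_exp (1:ℝ); linarith
  have h2 : ∀ i, Integrable (fun ω => Real.exp (t * X i ω ^ 2)) P := by
    intro i
    have := (h1 i).1
    rw [← hl i] at this
    exact (integrable_map_measure (by fun_prop) (hm i).aemeasurable).1 this
  have h3 : ∀ i, mgf (fun ω => X i ω ^ 2) P t ≤ Real.exp 1 := by
    intro i
    have := (h1 i).2
    rw [← hl i, integral_map (hm i).aemeasurable (by fun_prop)] at this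
    exact this
  have hi2 : iIndepFun (fun i ω => X i ω ^ 2) P :=
    hi.comp (fun _ x => x ^ 2) (fun _ => by fun_prop)
  have hint := hi2.integrable_exp_mul_sum (t := t) (s := Finset.univ) (fun i => by have := hm i; fun_prop) (fun i _ => h2 i)
  have hc := measure_ge_le_exp_mul_mgf (μ := P) (K * M * S) htp.le hint
  rw [hi2.mgf_sum (fun i => by have := hm i; fun_prop)] at hc
  have hset : {ω | K * M * S ≤ (∑ i, fun ω => X i ω ^ 2) ω} = {ω | K * M * S ≤ ∑ i, X i ω ^ 2} := by
    ext ω; simp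
  rw [hset] at hc
  rw [← ENNReal.ofReal_toReal (measure_ne_top P {ω | K * M * S ≤ ∑ i, X i ω ^ 2})]
  apply ENNReal.ofReal_le_ofReal
  refine hc.trans ?_
  have h4 : ∏ i, mgf (fun ω => X i ω ^ 2) P t ≤ Real.exp 1 ^ M := by
    calc _ ≤ ∏ i : Fin M, Real.exp 1 := Finset.prod_le_prod (fun i _ => mgf_nonneg) (fun i _ => h3 i)
      _ = _ := by simp
  calc _ ≤ Real.exp (-t * (K * M * S)) * Real.exp 1 ^ M := by gcongr
    _ = _ := by
      rw [← Real.exp_nat_mul, ← Real.exp_add]; congr 1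
      rw [ht]; field_simp; ring

lemma chi_lower {Ω : Type*} [MeasurableSpace Ω] (P : Measure Ω) [IsProbabilityMeasure P]
    {M : ℕ} (X : Fin M → Ω → ℝ) (hm : ∀ i, Measurable (X i)) (hi : iIndepFun X P)
    (s : NNReal) (hl : ∀ i, P.map (X i) = gaussianReal 0 s) (hs : s ≠ 0) :
    P {ω | ∑ i, X i ω ^ 2 ≤ M * s / 4} ≤ ENNReal.ofReal (Real.exp (-(M / 4))) := by
  have hs' : (0:ℝ) < s := lt_of_le_of_ne s.2 (by exact_mod_cast hs.symm)
  set t : ℝ := -(3 / (2 * s)) with ht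
  have htp : t ≤ 0 := by rw [ht]; simp; positivity
  have hts : 2 * t * s = -3 := by rw [ht]; field_simp
  obtain ⟨a, b⟩ := gauss_sq_mgf s hs t (by linarith)
  have hb : ∫ x, Real.exp (t * x ^ 2) ∂(gaussianReal 0 s) = 1 / 2 := by
    rw [b, hts, show (1:ℝ) / (1 - -3) = (1 / 2) ^ 2 by norm_num]; exact Real.sqrt_sq (by norm_num)
  have h2 : ∀ i, Integrable (fun ω => Real.exp (t * X i ω ^ 2)) P := by
    intro i
    have := a
    rw [← hl i] at this
    exact (integrable_map_measure (by fun_prop) (hm i).aemeasurable).1 this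
  have h3 : ∀ i, mgf (fun ω => X i ω ^ 2) P t = 1 / 2 := by
    intro i
    have := hb
    rw [← hl i, integral_map (hm i).aemeasurable (by fun_prop)] at this
    exact this
  have hi2 : iIndepFun (fun i ω => X i ω ^ 2) P :=
    hi.comp (fun _ x => x ^ 2) (fun _ => by fun_prop)
  have hint := hi2.integrable_exp_mul_sum (t := t) (s := Finset.univ) (fun i => by have := hm i; fun_prop) (fun i _ => h2 i)
  have hc := measure_le_le_exp_mul_mgf (μ := P) (M * s / 4) htp hint
  rw [hi2.mgf_sum (fun i => by have := hm i; fun_prop)] at hc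
  have hset : {ω | (∑ i, fun ω => X i ω ^ 2) ω ≤ M * s / 4} = {ω | ∑ i, X i ω ^ 2 ≤ M * s / 4} := by
    ext ω; simp
  rw [hset] at hc
  rw [← ENNReal.ofReal_toReal (measure_ne_top P {ω | ∑ i, X i ω ^ 2 ≤ M * s / 4})]
  apply ENNReal.ofReal_le_ofReal
  refine hc.trans ?_
  simp only [h3, Finset.prod_const, Finset.card_univ, Fintype.card_fin]
  have h2e : (1:ℝ) / 2 ≤ Real.exp (-(5 / 8)) := by
    rw [show (1:ℝ) / 2 = Real.exp (-(Real.log 2)) by rw [Real.exp_neg, Real.exp_log (by norm_num)]; norm_num]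
    apply Real.exp_le_exp.2; have := Real.log_two_gt_d9; linarith
  calc _ ≤ Real.exp (-t * (M * s / 4)) * Real.exp (-(5 / 8)) ^ M := by gcongr
    _ = _ := by
      rw [← Real.exp_nat_mul, ← Real.exp_add]; congr 1
      rw [ht]; field_simp; ring

lemma lin_law {M : ℕ} (s : NNReal) (f : Fin M → ℝ) :
    (Measure.pi fun _ : Fin M => gaussianReal 0 s).map (fun v => ∑ b, f b * v b) =
      gaussianReal 0 (s * (∑ b, f b ^ 2).toNNReal) := by
  have hme : Measurable (fun v : Fin M → ℝ => ∑ b, f b * v b) := by fun_prop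
  have : IsProbabilityMeasure ((Measure.pi fun _ : Fin M => gaussianReal 0 s).map (fun v => ∑ b, f b * v b)) :=
    Measure.isProbabilityMeasure_map hme.aemeasurable
  apply Measure.ext_of_charFun
  ext t
  rw [charFun_gaussianReal, charFun_apply_real, integral_map hme.aemeasurable (by fun_prop)]
  have h1 : ∀ v : Fin M → ℝ, Complex.exp (t * ((∑ b, f b * v b : ℝ) : ℂ) * Complex.I) =
      ∏ b, Complex.exp (((t * f b : ℝ) : ℂ) * (v b : ℂ) * Complex.I) := by
    intro v
    rw [← Complex.exp_sum]; congr 1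
    push_cast
    rw [Finset.mul_sum, Finset.sum_mul]
    exact Finset.sum_congr rfl fun b _ => by ring
  simp_rw [h1]
  rw [integral_fintype_prod_eq_prod (f := fun b (x : ℝ) => Complex.exp (((t * f b : ℝ) : ℂ) * (x : ℂ) * Complex.I))]
  have h2 : ∀ b, ∫ x, Complex.exp (((t * f b : ℝ) : ℂ) * (x : ℂ) * Complex.I) ∂(gaussianReal 0 s) =
     Complex.exp (((t * f b : ℝ) : ℂ) * (0:ℝ) * Complex.I - s * ((t * f b : ℝ) : ℂ) ^ 2 / 2) := by
    intro b
    rw [← charFun_apply_real, charFun_gaussianReal]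
  simp_rw [h2]
  rw [← Complex.exp_sum]
  congr 1
  have hsum : ((s * (∑ b, f b ^ 2).toNNReal : NNReal) : ℂ) = ((s * ∑ b, f b ^ 2 : ℝ) : ℂ) := by
    have h0 : 0 ≤ ∑ b, f b ^ 2 := Finset.sum_nonneg fun b _ => sq_nonneg _
    have : ((s * (∑ b, f b ^ 2).toNNReal : NNReal) : ℝ) = s * ∑ b, f b ^ 2 := by
      rw [NNReal.coe_mul, Real.coe_toNNReal _ h0]
    exact_mod_cast congrArg (fun x : ℝ => (x : ℂ)) this
  rw [hsum]
  push_cast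
  rw [Finset.mul_sum, Finset.sum_mul, Finset.sum_div]
  simp only [mul_zero, zero_mul, zero_sub, Finset.sum_neg_distrib]
  try congr 1
  exact Finset.sum_congr rfl fun b _ => by ring

lemma swap_law {n d : ℕ} (s : NNReal) :
    (Measure.pi fun _ : Fin n => Measure.pi fun _ : Fin d => gaussianReal 0 s).map
      (fun v b i => v i b) =
    (Measure.pi fun _ : Fin d => Measure.pi fun _ : Fin n => gaussianReal 0 s) := by
  have A : ∀ p q : ℕ, (Measure.pi fun _ : Fin p => Measure.pi fun _ : Fin q => gaussianReal 0 s) =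
      (Measure.pi fun _ : Fin p × Fin q => gaussianReal 0 s).map (MeasurableEquiv.curry (Fin p) (Fin q) ℝ) := by
    intro p q
    have := Measure.infinitePi_map_curry (ι := Fin p) (κ := Fin q) (fun _ _ => gaussianReal 0 s)
    simp only [Measure.infinitePi_eq_pi] at this
    exact this.symm
  rw [A n d, A d n, Measure.map_map (by fun_prop) (MeasurableEquiv.measurable _)]
  have B : (Measure.pi fun _ : Fin d × Fin n => gaussianReal 0 s) =
     (Measure.pi fun _ : Fin n × Fin d => gaussianReal 0 s).map (fun w p => w (p.2, p.1)) := by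
    symm
    have := measurePreserving_piCongrLeft (fun _ : Fin d × Fin n => gaussianReal 0 s) (Equiv.prodComm (Fin n) (Fin d))
    have h := this.map_eq
    convert h using 2
    ext w p
    exact ((MeasurableEquiv.piCongrLeft_apply_apply (β := fun _ => ℝ) (e := Equiv.prodComm (Fin n) (Fin d)) w (p.2, p.1))).symm
  rw [B, Measure.map_map (MeasurableEquiv.measurable _) (by fun_prop)]
  rfl

abbrev PV (n d : ℕ) : Measure (Fin n → Fin d → ℝ) := Measure.pi fun _ : Fin n => stdGaussianVec d

instance (d : ℕ) : IsProbabilityMeasure (stdGaussianVec d) := by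
  unfold stdGaussianVec; infer_instance

lemma rowgen_facts {M q : ℕ} (s : NNReal) (f : Fin M → Fin q → ℝ) :
    (∀ i, Measurable (fun v : Fin M → Fin q → ℝ => ∑ b, f i b * v i b)) ∧
    iIndepFun (fun i (v : Fin M → Fin q → ℝ) => ∑ b, f i b * v i b)
      (Measure.pi fun _ : Fin M => Measure.pi fun _ : Fin q => gaussianReal 0 s) ∧
    ∀ i, (Measure.pi fun _ : Fin M => Measure.pi fun _ : Fin q => gaussianReal 0 s).map
      (fun v => ∑ b, f i b * v i b) = gaussianReal 0 (s * (∑ b, f i b ^ 2).toNNReal) := by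
  refine ⟨fun i => by fun_prop, ?_, ?_⟩
  · exact iIndepFun_pi (X := fun i (w : Fin q → ℝ) => ∑ b, f i b * w b)
      (fun i => Measurable.aemeasurable (by fun_prop))
  · intro i
    rw [← lin_law s (f i)]
    have := (measurePreserving_eval (fun _ : Fin M => Measure.pi fun _ : Fin q => gaussianReal 0 s) i).map_eq
    conv_rhs => rw [← this, Measure.map_map (by fun_prop) (by fun_prop)]
    rfl

lemma rowgen_upper {M q : ℕ} (s : NNReal) (f : Fin M → Fin q → ℝ) (S : ℝ) (hS : 0 < S)
    (hf : ∀ i, s * ∑ b, f i b ^ 2 ≤ S) (K : ℝ) :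
    (Measure.pi fun _ : Fin M => Measure.pi fun _ : Fin q => gaussianReal 0 s)
      {v | K * M * S ≤ ∑ i, (∑ b, f i b * v i b) ^ 2} ≤ ENNReal.ofReal (Real.exp (-(M * (K / 4 - 1)))) := by
  obtain ⟨h1, h2, h3⟩ := rowgen_facts s f
  refine chi_upper _ _ h1 h2 _ h3 S hS (fun i => ?_) K
  rw [NNReal.coe_mul, Real.coe_toNNReal _ (Finset.sum_nonneg fun b _ => sq_nonneg _)]
  exact hf i

lemma rowgen_lower {M q : ℕ} (s : NNReal) (hs : s ≠ 0) (f : Fin q → ℝ) (hf : 0 < ∑ b, f b ^ 2) :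
    (Measure.pi fun _ : Fin M => Measure.pi fun _ : Fin q => gaussianReal 0 s)
      {v | ∑ i, (∑ b, f b * v i b) ^ 2 ≤ M * (s * ∑ b, f b ^ 2) / 4} ≤ ENNReal.ofReal (Real.exp (-(M / 4))) := by
  obtain ⟨h1, h2, h3⟩ := rowgen_facts (M := M) s (fun _ => f)
  have := chi_lower _ _ h1 h2 _ h3 (mul_ne_zero hs (by simpa using hf))
  rwa [NNReal.coe_mul, Real.coe_toNNReal _ hf.le] at this

lemma swap_apply_le {n d : ℕ} (s : NNReal) (A : Set (Fin d → Fin n → ℝ)) :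
    (Measure.pi fun _ : Fin n => Measure.pi fun _ : Fin d => gaussianReal 0 s) ((fun v b i => v i b) ⁻¹' A) ≤
    (Measure.pi fun _ : Fin d => Measure.pi fun _ : Fin n => gaussianReal 0 s) A := by
  conv_rhs => rw [← swap_law s]
  have h : Measurable (fun (v : Fin n → Fin d → ℝ) b i => v i b) := by fun_prop
  exact Measure.le_map_apply h.aemeasurable A

lemma row_upper {n d : ℕ} (hd : 0 < d) (f : Fin n → Fin d → ℝ)
    (hf : ∀ i, ∑ b, f i b ^ 2 ≤ 1) (K : ℝ) :
    PV n d {v | K * (n / d) ≤ ∑ i, (∑ b, f i b * v i b) ^ 2}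
      ≤ ENNReal.ofReal (Real.exp (-(n * (K / 4 - 1)))) := by
  have hd' : (0:ℝ) < d := by exact_mod_cast hd
  have := rowgen_upper ((d : NNReal)⁻¹) f (1 / d) (by positivity) (fun i => by
    have := hf i
    push_cast
    rw [inv_mul_eq_div]; gcongr) K
  simp only [PV, stdGaussianVec]
  convert this using 5
  ring

lemma row_lower {n d : ℕ} (hd : 0 < d) (f : Fin d → ℝ) (hf : ∑ b, f b ^ 2 = 1) :
    PV n d {v | ∑ i, (∑ b, f b * v i b) ^ 2 ≤ n / (4 * d)}
      ≤ ENNReal.ofReal (Real.exp (-(n / 4))) := by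
  have hd' : (0:ℝ) < d := by exact_mod_cast hd
  have := rowgen_lower (M := n) ((d : NNReal)⁻¹) (by positivity) f (by linarith)
  simp only [PV, stdGaussianVec]
  convert this using 5
  rw [hf]; push_cast; field_simp

lemma col_upper {n d : ℕ} (hd : 0 < d) (x : Fin n → ℝ) :
    PV n d {v | 8 * ∑ j, x j ^ 2 < ∑ b, (∑ j, x j * v j b) ^ 2}
      ≤ ENNReal.ofReal (Real.exp (-d)) := by
  have hd' : (0:ℝ) < d := by exact_mod_cast hd
  have h0 : 0 ≤ ∑ j, x j ^ 2 := Finset.sum_nonneg fun b _ => sq_nonneg _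
  rcases h0.eq_or_lt with h | h
  · have hx : ∀ j, x j = 0 := fun j => by
      have := (Finset.sum_eq_zero_iff_of_nonneg (fun b _ => sq_nonneg (x b))).1 h.symm j (Finset.mem_univ _)
      exact pow_eq_zero_iff (two_ne_zero) |>.1 this
    simp [hx]
  · have h1 := rowgen_upper ((d : NNReal)⁻¹) (fun _ : Fin d => x) ((∑ j, x j ^ 2) / d) (by positivity) (fun i => by
      push_cast
      rw [inv_mul_eq_div]) 8
    have h2 := (swap_apply_le _ _).trans h1
    simp only [PV, stdGaussianVec]
    refine (measure_mono ?_).trans (h2.trans (ENNReal.ofReal_le_ofReal (Real.exp_le_exp.2 (by linarith))))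
    intro v hv
    simp only [Set.mem_ofPred_eq, Set.mem_preimage] at hv ⊢
    refine le_trans (le_of_eq ?_) hv.le
    field_simp

lemma col_lower {n d : ℕ} (hd : 0 < d) (x : Fin n → ℝ) (hx : 0 < ∑ j, x j ^ 2) :
    PV n d {v | ∑ b, (∑ j, x j * v j b) ^ 2 ≤ (∑ j, x j ^ 2) / 4}
      ≤ ENNReal.ofReal (Real.exp (-(d / 4))) := by
  have hd' : (0:ℝ) < d := by exact_mod_cast hd
  have h1 := rowgen_lower (M := d) ((d : NNReal)⁻¹) (by positivity) x hx
  have h2 := (swap_apply_le _ _).trans h1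
  simp only [PV, stdGaussianVec]
  refine (measure_mono ?_).trans h2
  intro v hv
  simp only [Set.mem_ofPred_eq, Set.mem_preimage] at hv ⊢
  refine le_trans hv (le_of_eq ?_)
  push_cast
  field_simp

lemma exists_net (F : Type*) [NormedAddCommGroup F] [NormedSpace ℝ F] [FiniteDimensional ℝ F] :
    ∃ T : Finset F, T.card ≤ 5 ^ Module.finrank ℝ F ∧ (∀ t ∈ T, ‖t‖ ≤ 1) ∧
      ∀ x : F, ‖x‖ ≤ 1 → ∃ t ∈ T, ‖x - t‖ ≤ 1 / 2 := by
  classical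
  let Q : ℕ → Prop := fun m => ∃ T : Finset F, T.card = m ∧ (∀ t ∈ T, ‖t‖ ≤ 1) ∧
    ∀ c ∈ T, ∀ e ∈ T, c ≠ e → 1 / 2 < ‖c - e‖
  have hbound : ∀ m, Q m → m ≤ 5 ^ Module.finrank ℝ F := by
    rintro m ⟨T, rfl, h1, h2⟩
    have hinj : Function.Injective (fun x : F => (2:ℝ) • x) := smul_right_injective F two_ne_zero
    have := Besicovitch.card_le_of_separated (T.image (fun x : F => (2:ℝ) • x)) (by
      intro c hc
      obtain ⟨t, ht, rfl⟩ := Finset.mem_image.1 hc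
      rw [norm_smul]; simp only [Real.norm_ofNat]; linarith [h1 t ht]) (by
      intro c hc e he hce
      obtain ⟨t, ht, rfl⟩ := Finset.mem_image.1 hc
      obtain ⟨t', ht', rfl⟩ := Finset.mem_image.1 he
      rw [← smul_sub, norm_smul]; simp only [Real.norm_ofNat]
      have := h2 t ht t' ht' (fun h => hce (by rw [h]))
      linarith)
    rwa [Finset.card_image_of_injective _ hinj] at this
  have hQ0 : Q 0 := ⟨∅, by simp, by simp, by simp⟩
  have hg := Nat.findGreatest_spec (P := Q) (Nat.zero_le (5 ^ Module.finrank ℝ F)) hQ0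
  obtain ⟨T, hT, h1, h2⟩ := hg
  refine ⟨T, hT ▸ Nat.findGreatest_le _, h1, fun x hx => ?_⟩
  by_contra! hcon
  have hxT : x ∉ T := fun h => by have := hcon x h; simp at this; linarith
  have hQ : Q (T.card + 1) := by
    refine ⟨insert x T, Finset.card_insert_of_notMem hxT, ?_, ?_⟩
    · intro t ht
      rcases Finset.mem_insert.1 ht with rfl | h
      · exact hx
      · exact h1 t h
    · intro c hc e he hce
      rcases Finset.mem_insert.1 hc with rfl | h <;> rcases Finset.mem_insert.1 he with rfl | h'
      · exact absurd rfl hce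
      · exact hcon e h'
      · rw [norm_sub_rev]; exact hcon c h
      · exact h2 c h e h' hce
  have := Nat.le_findGreatest (hbound _ hQ) hQ
  omega

lemma net_seminorm {F : Type*} [NormedAddCommGroup F] [NormedSpace ℝ F]
    (p : Seminorm ℝ F) (C : ℝ) (hC : ∀ x, p x ≤ C * ‖x‖) (T : Finset F) 
    (hnet : ∀ x : F, ‖x‖ ≤ 1 → ∃ t ∈ T, ‖x - t‖ ≤ 1 / 2) (B : ℝ) (hB : ∀ t ∈ T, p t ≤ B) (x : F) :
    p x ≤ 2 * B * ‖x‖ := by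
  set S : Set ℝ := p '' {x | ‖x‖ ≤ 1} with hS
  have hSne : S.Nonempty := ⟨p 0, 0, by simp, rfl⟩
  have hC0 : 0 ≤ |C| := abs_nonneg C
  have hSb : BddAbove S := ⟨|C|, by
    rintro _ ⟨y, hy, rfl⟩
    refine (hC y).trans ?_
    simp only [Set.mem_ofPred_eq] at hy
    calc C * ‖y‖ ≤ |C| * ‖y‖ := by gcongr; exact le_abs_self C
      _ ≤ |C| * 1 := by gcongr
      _ = |C| := mul_one _⟩
  have hle : ∀ y : F, p y ≤ sSup S * ‖y‖ := by
    intro y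
    by_cases hy : y = 0
    · simp [hy]
    · have hn : 0 < ‖y‖ := norm_pos_iff.2 hy
      have : p (‖y‖⁻¹ • y) ≤ sSup S := le_csSup hSb ⟨_, by simp [norm_smul, hn.ne'], rfl⟩
      rw [map_smul_eq_mul, norm_inv, norm_norm] at this
      rwa [inv_mul_le_iff₀ hn, mul_comm] at this
  have hs0 : 0 ≤ sSup S := le_csSup_of_le hSb ⟨0, by simp, rfl⟩ (apply_nonneg p 0)
  have hsup : sSup S ≤ B + sSup S / 2 := by
    apply csSup_le hSne
    rintro _ ⟨y, hy, rfl⟩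
    obtain ⟨t, ht, hyt⟩ := hnet y hy
    calc p y = p (t + (y - t)) := by congr 1; abel
      _ ≤ p t + p (y - t) := map_add_le_add p _ _
      _ ≤ B + sSup S * ‖y - t‖ := add_le_add (hB t ht) (hle _)
      _ ≤ B + sSup S * (1 / 2) := by gcongr
      _ = _ := by ring
  calc p x ≤ sSup S * ‖x‖ := hle x
    _ ≤ 2 * B * ‖x‖ := by gcongr; linarith

lemma net_prob {n d : ℕ} (hd : 0 < d) (F : Submodule ℝ (Fin n → EuclideanSpace ℝ (Fin d)))
    (hF : Module.finrank ℝ F ≤ d ^ 2) (K : ℝ) (hK0 : 0 ≤ K) (hK : 3 * (d:ℝ) ^ 2 ≤ n * (K / 4 - 1)) :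
    PV n d {v | ∃ f ∈ F, 4 * K * (n / d) * ‖f‖ ^ 2 < ∑ i, (∑ b, f i b * v i b) ^ 2}
      ≤ ENNReal.ofReal (Real.exp (-d)) := by
  have hd' : (1:ℝ) ≤ d := by exact_mod_cast hd
  obtain ⟨T, hTc, hT1, hTn⟩ := exists_net F
  have hsub : {v : Fin n → Fin d → ℝ | ∃ f ∈ F, 4 * K * (n / d) * ‖f‖ ^ 2 < ∑ i, (∑ b, f i b * v i b) ^ 2} ⊆
      ⋃ t ∈ T, {v | K * (n / d) ≤ ∑ i, (∑ b, (t : Fin n → EuclideanSpace ℝ (Fin d)) i b * v i b) ^ 2} := by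
    intro v hv
    by_contra hcon
    simp only [Set.mem_iUnion, not_exists, Set.mem_ofPred_eq, not_le] at hcon
    obtain ⟨f, hf, hlt⟩ := hv
    let Lm : F →ₗ[ℝ] EuclideanSpace ℝ (Fin n) :=
      { toFun := fun g => WithLp.toLp 2 (fun i => ∑ b, (g : Fin n → EuclideanSpace ℝ (Fin d)) i b * v i b)
        map_add' := by
          intro g h; ext i
          simp [add_mul, Finset.sum_add_distrib]
        map_smul' := by
          intro c g; ext i
          simp [Finset.mul_sum, mul_assoc] }
    let p : Seminorm ℝ F := (normSeminorm ℝ (EuclideanSpace ℝ (Fin n))).comp Lm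
    have hp : ∀ g, p g = Real.sqrt (∑ i, (∑ b, (g : Fin n → EuclideanSpace ℝ (Fin d)) i b * v i b) ^ 2) := by
      intro g
      change ‖Lm g‖ = _
      rw [EuclideanSpace.norm_eq]
      simp [Lm]
    have := net_seminorm p ‖LinearMap.toContinuousLinearMap Lm‖
      (fun x => (LinearMap.toContinuousLinearMap Lm).le_opNorm x) T hTn (Real.sqrt (K * (n / d)))
      (fun t ht => by rw [hp]; exact Real.sqrt_le_sqrt (hcon t ht).le) ⟨f, hf⟩
    rw [hp] at this
    have h0 : 0 ≤ K * (n / d : ℝ) := by positivity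
    have h2 := pow_le_pow_left₀ (Real.sqrt_nonneg _) this 2
    rw [Real.sq_sqrt (Finset.sum_nonneg fun b _ => sq_nonneg _), mul_pow, mul_pow, Real.sq_sqrt h0] at h2
    simp only [Submodule.coe_norm] at h2
    linarith
  have hT2 : ∀ t ∈ T, PV n d {v | K * (n / d) ≤ ∑ i, (∑ b, (t : Fin n → EuclideanSpace ℝ (Fin d)) i b * v i b) ^ 2}
      ≤ ENNReal.ofReal (Real.exp (-(3 * (d:ℝ) ^ 2))) := by
    intro t ht
    refine (row_upper hd (fun i b => (t : Fin n → EuclideanSpace ℝ (Fin d)) i b) (fun i => ?_) K).trans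
      (ENNReal.ofReal_le_ofReal (Real.exp_le_exp.2 (by linarith)))
    have h1 : ‖(t : Fin n → EuclideanSpace ℝ (Fin d)) i‖ ≤ 1 := (norm_le_pi_norm _ i).trans (hT1 t ht)
    rw [← EuclideanSpace.real_norm_sq_eq]
    exact pow_le_one₀ (norm_nonneg _) h1
  calc _ ≤ _ := measure_mono hsub
    _ ≤ ∑ t ∈ T, _ := measure_biUnion_finset_le _ _
    _ ≤ ∑ t ∈ T, ENNReal.ofReal (Real.exp (-(3 * (d:ℝ) ^ 2))) := Finset.sum_le_sum hT2
    _ = ENNReal.ofReal (T.card * Real.exp (-(3 * (d:ℝ) ^ 2))) := by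
      rw [Finset.sum_const, nsmul_eq_mul, ENNReal.ofReal_mul (by positivity), ENNReal.ofReal_natCast]
    _ ≤ _ := by
      apply ENNReal.ofReal_le_ofReal
      have h5 : (T.card : ℝ) ≤ Real.exp 2 ^ (d ^ 2) := by
        calc (T.card : ℝ) ≤ (5:ℝ) ^ (Module.finrank ℝ F) := by exact_mod_cast hTc
          _ ≤ 5 ^ (d ^ 2) := pow_le_pow_right₀ (by norm_num) hF
          _ ≤ _ := by
            gcongr
            have h1 := Real.exp_one_gt_d9
            rw [show (2:ℝ) = 1 + 1 by norm_num, Real.exp_add]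
            nlinarith
      calc _ ≤ Real.exp 2 ^ (d ^ 2) * Real.exp (-(3 * (d:ℝ) ^ 2)) := by gcongr
        _ = Real.exp (-(d:ℝ)^2) := by
          rw [← Real.exp_nat_mul, ← Real.exp_add]; congr 1; push_cast; ring
        _ ≤ _ := Real.exp_le_exp.2 (by nlinarith)

lemma net_apply {n d : ℕ} (hd : 0 < d) {E : Type*} [AddCommGroup E] [Module ℝ E] [FiniteDimensional ℝ E]
    (hE : Module.finrank ℝ E ≤ d ^ 2) (L : E →ₗ[ℝ] (Fin n → Fin d → ℝ))
    (K : ℝ) (hK0 : 0 ≤ K) (hK : 3 * (d:ℝ) ^ 2 ≤ n * (K / 4 - 1)) :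
    PV n d {v | ∃ (w : E) (R : ℝ), 0 ≤ R ∧ (∀ i, ∑ b, L w i b ^ 2 ≤ R) ∧
        4 * K * (n / d) * R < ∑ i, (∑ b, L w i b * v i b) ^ 2}
      ≤ ENNReal.ofReal (Real.exp (-d)) := by
  let L2 : E →ₗ[ℝ] (Fin n → EuclideanSpace ℝ (Fin d)) :=
    { toFun := fun w i => WithLp.toLp 2 (L w i)
      map_add' := by intro x y; ext i b; simp
      map_smul' := by intro c x; ext i b; simp }
  have := net_prob hd (LinearMap.range L2) ((LinearMap.finrank_range_le L2).trans hE) K hK0 hK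
  refine (measure_mono ?_).trans this
  rintro v ⟨w, R, hR, h1, h2⟩
  refine ⟨L2 w, ⟨w, rfl⟩, lt_of_le_of_lt ?_ h2⟩
  have : ‖L2 w‖ ≤ Real.sqrt R := by
    rw [pi_norm_le_iff_of_nonneg (Real.sqrt_nonneg _)]
    intro i
    rw [EuclideanSpace.norm_eq]
    apply Real.sqrt_le_sqrt
    simpa [L2] using h1 i
  have h3 : ‖L2 w‖ ^ 2 ≤ R := by
    calc _ ≤ Real.sqrt R ^ 2 := by gcongr
      _ = R := Real.sq_sqrt hR
  gcongr

/-- softplus with unit temperature -/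
def Lsp (t : ℝ) : ℝ := Real.log (1 + Real.exp t)
/-- the logistic sigmoid -/
def sg (t : ℝ) : ℝ := Real.exp t / (1 + Real.exp t)

lemma sg_pos (t : ℝ) : 0 < sg t := by unfold sg; positivity
lemma sg_lt_one (t : ℝ) : sg t < 1 := by
  unfold sg; rw [div_lt_one (by positivity)]; linarith [Real.exp_pos t]

lemma Lsp_lower (y y0 : ℝ) : Lsp y0 + sg y0 * (y - y0) ≤ Lsp y := by
  have h1 : Real.exp (sg y0 * (y - y0)) ≤ (1 - sg y0) * 1 + sg y0 * Real.exp (y - y0) := by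
    have := convexOn_exp.2 (Set.mem_univ 0) (Set.mem_univ (y - y0))
      (by linarith [sg_lt_one y0] : 0 ≤ 1 - sg y0) (sg_pos y0).le (by ring)
    simpa using this
  have h2 : (1 + Real.exp y0) * ((1 - sg y0) * 1 + sg y0 * Real.exp (y - y0)) = 1 + Real.exp y := by
    rw [Real.exp_sub]; unfold sg
    have := Real.exp_pos y0
    field_simp
    ring
  unfold Lsp
  rw [← h2, Real.log_mul (by positivity) (by have := Real.exp_pos (sg y0 * (y - y0)); linarith)]
  gcongr
  calc _ = Real.log (Real.exp (sg y0 * (y - y0))) := (Real.log_exp _).symm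
    _ ≤ _ := Real.log_le_log (Real.exp_pos _) h1

lemma Lsp_upper (y y0 : ℝ) : Lsp y ≤ Lsp y0 + sg y0 * (y - y0) + (y - y0) ^ 2 / 2 := by
  have h1 := Lsp_lower (2 * y0 - y) y0
  have h2 : Lsp y + Lsp (2 * y0 - y) ≤ 2 * Lsp y0 + (y - y0) ^ 2 / 2 := by
    unfold Lsp
    have e : Real.exp ((y - y0) ^ 2 / 2) * (1 + Real.exp y0) ^ 2 ≥ (1 + Real.exp y) * (1 + Real.exp (2 * y0 - y)) := by
      have hc := Real.cosh_le_exp_half_sq (y - y0)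
      have hc1 := Real.one_le_cosh (y - y0)
      have ha : Real.exp y = Real.exp y0 * Real.exp (y - y0) := by rw [← Real.exp_add]; ring_nf
      have hb : Real.exp (2 * y0 - y) = Real.exp y0 * Real.exp (-(y - y0)) := by rw [← Real.exp_add]; ring_nf
      have hm : Real.exp (y - y0) * Real.exp (-(y - y0)) = 1 := by rw [← Real.exp_add]; simp
      have hp := Real.exp_pos y0
      calc (1 + Real.exp y) * (1 + Real.exp (2 * y0 - y))
          = 1 + 2 * Real.exp y0 * Real.cosh (y - y0) + Real.exp y0 ^ 2 := by
            rw [ha, hb, Real.cosh_eq]; linear_combination (Real.exp y0) ^ 2 * hm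
        _ ≤ Real.cosh (y - y0) * (1 + Real.exp y0) ^ 2 := by nlinarith [sq_nonneg (Real.exp y0)]
        _ ≤ _ := by gcongr
    have := Real.log_le_log (by positivity) e
    rw [Real.log_mul (by positivity) (by positivity), Real.log_mul (by positivity) (by positivity),
      Real.log_exp, Real.log_pow] at this
    push_cast at this
    linarith
  have h3 : sg y0 * (2 * y0 - y - y0) = - (sg y0 * (y - y0)) := by ring
  linarith

lemma Lsp_mono {x y : ℝ} (h : x ≤ y) : Lsp x ≤ Lsp y := by
  have := Lsp_lower y x
  nlinarith [sg_pos x]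

lemma Lsp_lip {x q : ℝ} (hq : 0 ≤ q) : Lsp (x + q) ≤ Lsp x + q := by
  have := Lsp_lower x (x + q)
  nlinarith [sg_lt_one (x + q)]

lemma Lsp_pos (t : ℝ) : 0 < Lsp t := Real.log_pos (by linarith [Real.exp_pos t])

lemma Lsp_ge (t : ℝ) : t ≤ Lsp t := by
  unfold Lsp
  calc t = Real.log (Real.exp t) := (Real.log_exp t).symm
    _ ≤ _ := Real.log_le_log (Real.exp_pos _) (by linarith)

lemma logistic_eq (t : ℝ) : logisticLoss t = Lsp (-t) := rfl
lemma softplus_eq (β t : ℝ) : softplus β t = Lsp (β * t) / β := rfl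

lemma softplus_lower {β : ℝ} (hβ : 0 < β) (y y0 : ℝ) :
    softplus β y0 + sg (β * y0) * (y - y0) ≤ softplus β y := by
  have := Lsp_lower (β * y) (β * y0)
  rw [softplus_eq, softplus_eq, le_div_iff₀ hβ, add_mul, div_mul_cancel₀ _ hβ.ne']
  linarith

lemma softplus_upper {β : ℝ} (hβ : 0 < β) (y y0 : ℝ) :
    softplus β y ≤ softplus β y0 + sg (β * y0) * (y - y0) + β / 2 * (y - y0) ^ 2 := by
  have := Lsp_upper (β * y) (β * y0)
  rw [softplus_eq, softplus_eq, div_le_iff₀ hβ, add_mul, add_mul, div_mul_cancel₀ _ hβ.ne']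
  linarith

lemma exists_y0 {β ρ : ℝ} (hβ : 0 < β) (h0 : 0 < ρ) (h1 : ρ < 1) :
    ∃ y0 : ℝ, sg (β * y0) = ρ ∧ y0 - softplus β y0 / ρ ≤ 0 := by
  have h1' : 0 < 1 - ρ := by linarith
  refine ⟨Real.log (ρ / (1 - ρ)) / β, ?_, ?_⟩
  · rw [mul_div_cancel₀ _ hβ.ne', sg, Real.exp_log (by positivity)]
    field_simp; ring
  · set y := Real.log (ρ / (1 - ρ)) / β
    have ha : 0 < softplus β y := div_pos (Lsp_pos _) hβ
    have hb : y ≤ softplus β y := by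
      rw [softplus_eq, le_div_iff₀ hβ, mul_comm]; exact Lsp_ge _
    have : softplus β y ≤ softplus β y / ρ := by
      rw [le_div_iff₀ h0]; nlinarith
    linarith

section margins
variable {n : ℕ} (i : Fin n) (s : Fin n → ℝ) (k : ℕ) (β y0 : ℝ)

lemma margin_le (hβ : 0 < β) (hk : 0 < k) (hn : 1 < n)
    (hy : sg (β * y0) = (k:ℝ) / ((n:ℝ) - 1)) (μ : ℝ) :
    s i - μ - (k:ℝ)⁻¹ * ∑ j ∈ Finset.univ.erase i, softplus β (s j - μ) ≤
      (y0 - softplus β y0 / ((k:ℝ) / ((n:ℝ) - 1))) +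
        (s i - ((n:ℝ) - 1)⁻¹ * ∑ j ∈ Finset.univ.erase i, s j) := by
  have hk' : (0:ℝ) < k := by exact_mod_cast hk
  have hn' : (0:ℝ) < (n:ℝ) - 1 := by
    have : (1:ℝ) < n := by exact_mod_cast hn
    linarith
  have hcard : ((Finset.univ.erase i).card : ℝ) = (n:ℝ) - 1 := by
    rw [Finset.card_erase_of_mem (Finset.mem_univ _), Finset.card_univ, Fintype.card_fin,
      Nat.cast_sub hn.le]; simp
  have h1 : ∑ j ∈ Finset.univ.erase i, (softplus β y0 + (k:ℝ) / ((n:ℝ) - 1) * (s j - μ - y0)) ≤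
      ∑ j ∈ Finset.univ.erase i, softplus β (s j - μ) :=
    Finset.sum_le_sum fun j _ => by rw [← hy]; exact softplus_lower hβ _ _
  rw [Finset.sum_add_distrib, ← Finset.mul_sum, Finset.sum_sub_distrib, Finset.sum_sub_distrib] at h1
  simp only [Finset.sum_const, nsmul_eq_mul, hcard] at h1
  have h2 := mul_le_mul_of_nonneg_left h1 (inv_nonneg.2 hk'.le)
  have h3 : (k:ℝ)⁻¹ * (((n:ℝ) - 1) * softplus β y0 + (k:ℝ) / ((n:ℝ) - 1) * ((∑ j ∈ Finset.univ.erase i, s j) - ((n:ℝ) - 1) * μ - ((n:ℝ) - 1) * y0))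
      = softplus β y0 / ((k:ℝ) / ((n:ℝ) - 1)) + ((n:ℝ) - 1)⁻¹ * (∑ j ∈ Finset.univ.erase i, s j) - μ - y0 := by
    field_simp
    ring
  linarith

lemma margin_ge (hβ : 0 < β) (hk : 0 < k) (hn : 1 < n)
    (hy : sg (β * y0) = (k:ℝ) / ((n:ℝ) - 1)) :
      (y0 - softplus β y0 / ((k:ℝ) / ((n:ℝ) - 1))) +
        (s i - ((n:ℝ) - 1)⁻¹ * ∑ j ∈ Finset.univ.erase i, s j)
        - β / (2 * k) * ∑ j ∈ Finset.univ.erase i, s j ^ 2 ≤ 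
    s i - (-y0) - (k:ℝ)⁻¹ * ∑ j ∈ Finset.univ.erase i, softplus β (s j - (-y0)) := by
  have hk' : (0:ℝ) < k := by exact_mod_cast hk
  have hn' : (0:ℝ) < (n:ℝ) - 1 := by
    have : (1:ℝ) < n := by exact_mod_cast hn
    linarith
  have hcard : ((Finset.univ.erase i).card : ℝ) = (n:ℝ) - 1 := by
    rw [Finset.card_erase_of_mem (Finset.mem_univ _), Finset.card_univ, Fintype.card_fin,
      Nat.cast_sub hn.le]; simp
  have h1 : ∑ j ∈ Finset.univ.erase i, softplus β (s j - (-y0)) ≤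
     ∑ j ∈ Finset.univ.erase i, (softplus β y0 + (k:ℝ) / ((n:ℝ) - 1) * s j + β / 2 * s j ^ 2) :=
    Finset.sum_le_sum fun j _ => by
      have := softplus_upper hβ (s j - (-y0)) y0
      rw [hy] at this
      simpa using this
  rw [Finset.sum_add_distrib, Finset.sum_add_distrib, ← Finset.mul_sum, ← Finset.mul_sum] at h1
  simp only [Finset.sum_const, nsmul_eq_mul, hcard] at h1
  have h2 := mul_le_mul_of_nonneg_left h1 (inv_nonneg.2 hk'.le)
  have h3 : (k:ℝ)⁻¹ * (((n:ℝ) - 1) * softplus β y0 + (k:ℝ) / ((n:ℝ) - 1) * (∑ j ∈ Finset.univ.erase i, s j) + β / 2 * ∑ j ∈ Finset.univ.erase i, s j ^ 2)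
      = softplus β y0 / ((k:ℝ) / ((n:ℝ) - 1)) + ((n:ℝ) - 1)⁻¹ * (∑ j ∈ Finset.univ.erase i, s j) + β / (2 * k) * ∑ j ∈ Finset.univ.erase i, s j ^ 2 := by
    field_simp
  linarith

end margins

lemma loss_ge {x ms δ : ℝ} (h : x ≤ ms + δ) : logisticLoss ms - sg (-ms) * δ ≤ logisticLoss x := by
  rw [logistic_eq, logistic_eq]
  have h1 := Lsp_mono (by linarith : -(ms + δ) ≤ -x)
  have h2 := Lsp_lower (-(ms + δ)) (-ms)
  have h3 : sg (-ms) * (-(ms + δ) - -ms) = - (sg (-ms) * δ) := by ring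
  linarith

lemma loss_le {x ms δ q : ℝ} (hq : 0 ≤ q) (h : ms + δ - q ≤ x) :
    logisticLoss x ≤ logisticLoss ms - sg (-ms) * δ + δ ^ 2 / 2 + q := by
  rw [logistic_eq, logistic_eq]
  have h1 := Lsp_mono (by linarith : -x ≤ -(ms + δ) + q)
  have h0 := Lsp_lip (x := -(ms + δ)) hq
  have h2 := Lsp_upper (-(ms + δ)) (-ms)
  have h3 : sg (-ms) * (-(ms + δ) - -ms) = - (sg (-ms) * δ) := by ring
  have h4 : (-(ms + δ) - -ms) ^ 2 = δ ^ 2 := by ring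
  rw [h3, h4] at h2
  linarith

lemma sg_half {t : ℝ} (h : 0 ≤ t) : 1 / 2 ≤ sg t := by
  unfold sg
  have := Real.one_le_exp h
  rw [div_le_div_iff₀ (by norm_num) (by positivity)]; linarith

/-- leave-one-out centred `u` -/
def cen {n d : ℕ} (u : Fin n → Fin d → ℝ) (i : Fin n) (a : Fin d) : ℝ :=
  u i a - ((n:ℝ) - 1)⁻¹ * ∑ j ∈ Finset.univ.erase i, u j a

/-- the negative gradient direction -/
def Gm {n d : ℕ} (u v : Fin n → Fin d → ℝ) : Matrix (Fin d) (Fin d) ℝ :=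
  fun a b => ∑ i, cen u i a * v i b

/-- scores -/
def sc {n d : ℕ} (u v : Fin n → Fin d → ℝ) (W : Matrix (Fin d) (Fin d) ℝ) (j i : Fin n) : ℝ :=
  u j ⬝ᵥ W.mulVec (v i)

/-- centred scores -/
def dl {n d : ℕ} (u v : Fin n → Fin d → ℝ) (W : Matrix (Fin d) (Fin d) ℝ) (i : Fin n) : ℝ :=
  sc u v W i i - ((n:ℝ) - 1)⁻¹ * ∑ j ∈ Finset.univ.erase i, sc u v W j i

lemma sum_dl {n d : ℕ} (u v : Fin n → Fin d → ℝ) (W : Matrix (Fin d) (Fin d) ℝ) :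
    ∑ i, dl u v W i = ∑ a, ∑ b, W a b * Gm u v a b := by
  have h : ∀ i, dl u v W i = ∑ a, ∑ b, W a b * (cen u i a * v i b) := by
    intro i
    simp only [dl, sc, cen, dotProduct, Matrix.mulVec]
    rw [Finset.sum_comm, Finset.mul_sum, ← Finset.sum_sub_distrib]
    refine Finset.sum_congr rfl fun a _ => ?_
    rw [← Finset.sum_mul, ← mul_assoc, ← sub_mul, Finset.mul_sum]
    exact Finset.sum_congr rfl fun b _ => by ring
  simp_rw [h, Gm, Finset.mul_sum]
  rw [Finset.sum_comm]
  exact Finset.sum_congr rfl fun a _ => Finset.sum_comm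

lemma sc_smul {n d : ℕ} (u v : Fin n → Fin d → ℝ) (W : Matrix (Fin d) (Fin d) ℝ) (ε : ℝ) (j i : Fin n) :
    sc u v (ε • W) j i = ε * sc u v W j i := by
  simp [sc, Matrix.smul_mulVec, dotProduct_smul]

lemma dl_smul {n d : ℕ} (u v : Fin n → Fin d → ℝ) (W : Matrix (Fin d) (Fin d) ℝ) (ε : ℝ) (i : Fin n) :
    dl u v (ε • W) i = ε * dl u v W i := by
  simp only [dl, sc_smul, ← Finset.mul_sum]; ring

lemma det_bound {n d k : ℕ} (u v : Fin n → Fin d → ℝ) (β lam : ℝ) (hβ : 0 < β) (hlam : 0 < lam)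
    (hd : 0 < d) (hk : 0 < k) (hkn : k + 1 < n) (c1 C2 C3 : ℝ) (hc1 : 0 < c1) (hC2 : 0 < C2) (hC3 : 0 < C3)
    (h1 : c1 * (d:ℝ) ^ 2 ≤ ∑ a, ∑ b, Gm u v a b ^ 2)
    (h3 : ∑ a, ∑ b, Gm u v a b ^ 2 ≤ C3 * (d:ℝ) ^ 2)
    (h2 : (∑ i, dl u v (Gm u v) i ^ 2) / 2 +
      β / (2 * k) * (∑ i, ∑ j ∈ Finset.univ.erase i, sc u v (Gm u v) j i ^ 2) +
      lam * n / (2 * (d:ℝ) ^ 2) * ∑ a, ∑ b, Gm u v a b ^ 2 ≤ C2 * (d:ℝ) ^ 2)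
    (W : Matrix (Fin d) (Fin d) ℝ) (μ : Fin n → ℝ)
    (hmin : ∀ (W' : Matrix (Fin d) (Fin d) ℝ) (μ' : Fin n → ℝ),
      tamObjective u v k β lam W μ ≤ tamObjective u v k β lam W' μ') :
    c1 ^ 2 / (16 * C2 * Real.sqrt C3) ≤ Real.sqrt (∑ a, ∑ b, W a b ^ 2) / d := by
  have hd' : (0:ℝ) < d := by exact_mod_cast hd
  have hk' : (0:ℝ) < k := by exact_mod_cast hk
  have hkn' : (k:ℝ) + 1 < n := by exact_mod_cast hkn
  have hn : 1 < n := by omega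
  obtain ⟨y0, hy, hms⟩ := exists_y0 (ρ := (k:ℝ) / ((n:ℝ) - 1)) hβ (div_pos hk' (by linarith))
    ((div_lt_one (by linarith)).2 (by linarith))
  set ms := y0 - softplus β y0 / ((k:ℝ) / ((n:ℝ) - 1)) with hmsd
  set a0 := sg (-ms) with ha0
  have ha1 : 1 / 2 ≤ a0 := sg_half (by linarith)
  have ha2 : a0 ≤ 1 := (sg_lt_one _).le
  set A := ∑ a, ∑ b, Gm u v a b ^ 2 with hA
  -- lower bound
  have hlow : (n:ℝ) * logisticLoss ms - a0 * ∑ a, ∑ b, W a b * Gm u v a b ≤ tamObjective u v k β lam W μ := by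
    rw [← sum_dl]
    have : ∑ i : Fin n, (logisticLoss ms - a0 * dl u v W i) ≤ ∑ i : Fin n, logisticLoss ((u i ⬝ᵥ W.mulVec (v i)) - μ i -
      (k : ℝ)⁻¹ * ∑ j ∈ Finset.univ.erase i, softplus β ((u j ⬝ᵥ W.mulVec (v i)) - μ i)) :=
      Finset.sum_le_sum fun i _ => loss_ge (margin_le i (fun j => sc u v W j i) k β y0 hβ hk hn hy (μ i))
    rw [Finset.sum_sub_distrib, ← Finset.mul_sum] at this
    simp only [Finset.sum_const, Finset.card_univ, Fintype.card_fin, nsmul_eq_mul] at this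
    have hnn : 0 ≤ lam * n / (2 * (d : ℝ) ^ 2) * ∑ a, ∑ b, W a b ^ 2 :=
      mul_nonneg (by positivity) (Finset.sum_nonneg fun _ _ => Finset.sum_nonneg fun _ _ => sq_nonneg _)
    unfold tamObjective
    linarith
  -- upper bound
  set ε := c1 / (4 * C2) with hε
  have hεp : 0 < ε := by positivity
  have hup : tamObjective u v k β lam (ε • Gm u v) (fun _ => -y0) ≤
      n * logisticLoss ms - a0 * (ε * A) + ε ^ 2 * (C2 * (d:ℝ) ^ 2) := by
    have h5 : ∑ i : Fin n, logisticLoss ((u i ⬝ᵥ (ε • Gm u v).mulVec (v i)) - (-y0) -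
      (k : ℝ)⁻¹ * ∑ j ∈ Finset.univ.erase i, softplus β ((u j ⬝ᵥ (ε • Gm u v).mulVec (v i)) - (-y0))) ≤
      ∑ i : Fin n, (logisticLoss ms - a0 * dl u v (ε • Gm u v) i + dl u v (ε • Gm u v) i ^ 2 / 2 +
        β / (2 * k) * ∑ j ∈ Finset.univ.erase i, sc u v (ε • Gm u v) j i ^ 2) :=
      Finset.sum_le_sum fun i _ => loss_le
        (mul_nonneg (by positivity) (Finset.sum_nonneg fun _ _ => sq_nonneg _))
        (margin_ge i (fun j => sc u v (ε • Gm u v) j i) k β y0 hβ hk hn hy)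
    rw [Finset.sum_add_distrib, Finset.sum_add_distrib, Finset.sum_sub_distrib, ← Finset.mul_sum,
      ← Finset.mul_sum, ← Finset.sum_div] at h5
    simp only [Finset.sum_const, Finset.card_univ, Fintype.card_fin, nsmul_eq_mul, dl_smul, sc_smul,
      mul_pow, ← Finset.mul_sum] at h5
    have hdl : ∑ i, dl u v (Gm u v) i = A := by
      rw [sum_dl, hA]
      exact Finset.sum_congr rfl fun a _ => Finset.sum_congr rfl fun b _ => by ring
    rw [hdl] at h5
    have hreg : ∑ a, ∑ b, (ε • Gm u v) a b ^ 2 = ε ^ 2 * A := by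
      rw [hA, Finset.mul_sum]
      refine Finset.sum_congr rfl fun a _ => ?_
      rw [Finset.mul_sum]
      exact Finset.sum_congr rfl fun b _ => by simp [Matrix.smul_apply, mul_pow]
    unfold tamObjective
    rw [hreg]
    have h6 := mul_le_mul_of_nonneg_left h2 (sq_nonneg ε)
    linarith
  have hcomb := hlow.trans ((hmin _ _).trans hup)
  -- Cauchy-Schwarz
  have hcs : ∑ a, ∑ b, W a b * Gm u v a b ≤ Real.sqrt (∑ a, ∑ b, W a b ^ 2) * Real.sqrt A := by
    have := Real.sum_mul_le_sqrt_mul_sqrt (Finset.univ : Finset (Fin d × Fin d)) (fun p => W p.1 p.2) (fun p => Gm u v p.1 p.2)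
    simpa only [Fintype.sum_prod_type] using this
  have hsA : Real.sqrt A ≤ Real.sqrt C3 * d := by
    rw [← Real.sqrt_sq hd'.le, ← Real.sqrt_mul hC3.le]
    exact Real.sqrt_le_sqrt h3
  set w := Real.sqrt (∑ a, ∑ b, W a b ^ 2) with hw
  have hw0 : 0 ≤ w := Real.sqrt_nonneg _
  have hcs2 : ∑ a, ∑ b, W a b * Gm u v a b ≤ w * (Real.sqrt C3 * d) := hcs.trans (by gcongr)
  have hB0 : 0 ≤ w * (Real.sqrt C3 * d) := by positivity
  have hfin : c1 ^ 2 / (16 * C2) * (d:ℝ) ^ 2 ≤ w * (Real.sqrt C3 * d) := by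
    have e1 : a0 * (ε * A) ≥ 1 / 2 * (ε * (c1 * (d:ℝ) ^ 2)) := by gcongr
    have e2 : a0 * ∑ a, ∑ b, W a b * Gm u v a b ≤ w * (Real.sqrt C3 * d) := by
      calc _ ≤ a0 * (w * (Real.sqrt C3 * d)) := by gcongr
        _ ≤ 1 * (w * (Real.sqrt C3 * d)) := by gcongr
        _ = _ := one_mul _
    have e3 : 1 / 2 * (ε * (c1 * (d:ℝ) ^ 2)) - ε ^ 2 * (C2 * (d:ℝ) ^ 2) = c1 ^ 2 / (16 * C2) * (d:ℝ) ^ 2 := by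
      rw [hε]; field_simp; ring
    linarith
  have hs3 : 0 < Real.sqrt C3 := Real.sqrt_pos.2 hC3
  rw [div_le_div_iff₀ (by positivity) hd']
  rw [div_mul_eq_mul_div, div_le_iff₀ (by positivity)] at hfin
  have : c1 ^ 2 * d * d ≤ (w * (16 * C2 * Real.sqrt C3)) * d := by nlinarith
  exact le_of_mul_le_mul_right this hd'

lemma centre_sum {n : ℕ} (hn : 2 ≤ n) (p : Fin n → ℝ) :
    ∑ i, (p i - ((n : ℝ) - 1)⁻¹ * ∑ j ∈ Finset.univ.erase i, p j) ^ 2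
      = ((n : ℝ) / ((n : ℝ) - 1)) ^ 2 * (∑ i, p i ^ 2 - (∑ i, p i) ^ 2 / n) := by
  have hn' : (2 : ℝ) ≤ n := by exact_mod_cast hn
  have h1 : (n : ℝ) - 1 ≠ 0 := by linarith
  have h0 : (n : ℝ) ≠ 0 := by linarith
  set S := ∑ i, p i with hS
  have hp : ∀ i, (p i - ((n : ℝ) - 1)⁻¹ * ∑ j ∈ Finset.univ.erase i, p j)
      = (n : ℝ) / ((n : ℝ) - 1) * (p i - S / n) := by
    intro i
    have : ∑ j ∈ Finset.univ.erase i, p j = S - p i := by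
      rw [hS, ← Finset.add_sum_erase _ _ (Finset.mem_univ i)]; ring
    rw [this]; field_simp; ring
  simp_rw [hp, mul_pow]
  rw [← Finset.mul_sum]
  congr 1
  have : ∀ i, (p i - S / n) ^ 2 = p i ^ 2 - 2 * (S / n) * p i + (S / n) ^ 2 := fun i => by ring
  simp_rw [this]
  rw [Finset.sum_add_distrib, Finset.sum_sub_distrib, ← Finset.mul_sum, ← hS]
  simp only [Finset.sum_const, Finset.card_univ, Fintype.card_fin, nsmul_eq_mul]
  field_simp; ring

lemma var_nonneg {n : ℕ} (hn : 2 ≤ n) (p : Fin n → ℝ) :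
    0 ≤ ∑ i, p i ^ 2 - (∑ i, p i) ^ 2 / n := by
  have hn' : (2 : ℝ) ≤ n := by exact_mod_cast hn
  have := sq_sum_le_card_mul_sum_sq (s := Finset.univ) (f := p)
  simp only [Finset.card_univ, Fintype.card_fin] at this
  rw [sub_nonneg, div_le_iff₀ (by linarith)]; linarith

lemma centre_upper {n : ℕ} (hn : 2 ≤ n) (p : Fin n → ℝ) :
    ∑ i, (p i - ((n : ℝ) - 1)⁻¹ * ∑ j ∈ Finset.univ.erase i, p j) ^ 2 ≤ 4 * ∑ i, p i ^ 2 := by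
  rw [centre_sum hn]
  have hn' : (2 : ℝ) ≤ n := by exact_mod_cast hn
  have h2 : ((n : ℝ) / ((n : ℝ) - 1)) ^ 2 ≤ 4 := by
    have h3 : (n : ℝ) / ((n : ℝ) - 1) ≤ 2 := by rw [div_le_iff₀ (by linarith)]; linarith
    have h4 : 0 ≤ (n : ℝ) / ((n : ℝ) - 1) := div_nonneg (by linarith) (by linarith)
    nlinarith
  refine mul_le_mul h2 ?_ (var_nonneg hn p) (by norm_num)
  have : 0 ≤ (∑ i, p i) ^ 2 / n := by positivity
  linarith

lemma centre_lower {n : ℕ} (hn : 2 ≤ n) (p : Fin n → ℝ) :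
    ∑ i, p i ^ 2 - (∑ i, p i) ^ 2 / n ≤
    ∑ i, (p i - ((n : ℝ) - 1)⁻¹ * ∑ j ∈ Finset.univ.erase i, p j) ^ 2 := by
  rw [centre_sum hn]
  have hn' : (2 : ℝ) ≤ n := by exact_mod_cast hn
  have h2 : 1 ≤ ((n : ℝ) / ((n : ℝ) - 1)) ^ 2 := by
    have h3 : 1 ≤ (n : ℝ) / ((n : ℝ) - 1) := by rw [le_div_iff₀ (by linarith)]; linarith
    nlinarith
  exact le_mul_of_one_le_left (var_nonneg hn p) h2

lemma measure_exists_le {Ω ι : Type*} [MeasurableSpace Ω] [Fintype ι] (P : Measure Ω)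
    (A : ι → Set Ω) (ε : ENNReal) (h : ∀ i, P (A i) ≤ ε) :
    P {x | ∃ i, x ∈ A i} ≤ Fintype.card ι * ε := by
  have : {x | ∃ i, x ∈ A i} = ⋃ i, A i := by ext; simp
  rw [this]
  refine (measure_iUnion_fintype_le P A).trans ?_
  refine (Finset.sum_le_sum fun i _ => h i).trans ?_
  simp

lemma measure_union4 {Ω : Type*} [MeasurableSpace Ω] {P : Measure Ω}
    {A1 A2 A3 A4 B : Set Ω} {e1 e2 e3 e4 : ENNReal} (h1 : P A1 ≤ e1) (h2 : P A2 ≤ e2)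
    (h3 : P A3 ≤ e3) (h4 : P A4 ≤ e4)
    (h : ∀ x, x ∉ A1 → x ∉ A2 → x ∉ A3 → x ∉ A4 → x ∉ B) :
    P B ≤ (e1 + e2) + (e3 + e4) := by
  have hsub : B ⊆ (A1 ∪ A2) ∪ (A3 ∪ A4) := by
    intro x hx
    by_contra hc
    simp only [Set.mem_union, not_or] at hc
    exact h x hc.1.1 hc.1.2 hc.2.1 hc.2.2 hx
  refine (measure_mono hsub).trans ((measure_union_le _ _).trans ?_)
  exact add_le_add ((measure_union_le _ _).trans (add_le_add h1 h2))
    ((measure_union_le _ _).trans (add_le_add h3 h4))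

/-- Good event for `u`. -/
def GU (K : ℝ) {n d : ℕ} (u : Fin n → Fin d → ℝ) : Prop :=
  (∀ a, (n : ℝ) / (8 * d) ≤ ∑ i, cen u i a ^ 2) ∧ (∀ a, ∑ i, cen u i a ^ 2 ≤ 16 * K * (n / d)) ∧
  (∀ i, ∑ j, (∑ a, cen u j a * u i a) ^ 2 ≤ 128 * K * (n / d))

/-- Good event for the pair. -/
def GV (K : ℝ) {n d : ℕ} (u v : Fin n → Fin d → ℝ) : Prop :=
  (n : ℝ) / 32 ≤ ∑ a, ∑ b, Gm u v a b ^ 2 ∧ ∑ a, ∑ b, Gm u v a b ^ 2 ≤ 128 * K * n ∧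
  ∑ i, sc u v (Gm u v) i i ^ 2 ≤ 4096 * K ^ 2 * (n / d) ^ 2 ∧
  ∑ j, ∑ i, sc u v (Gm u v) j i ^ 2 ≤ 4096 * K ^ 2 * (n / d) ^ 2 * n

lemma e1_prob {n d : ℕ} (hd : 0 < d) (K : ℝ) (hK0 : 0 ≤ K) (hK : 3 * (d : ℝ) ^ 2 ≤ n * (K / 4 - 1)) :
    PV n d {v | ∃ x : Fin d → ℝ, 4 * K * (n / d) * (∑ b, x b ^ 2) < ∑ i, (∑ b, x b * v i b) ^ 2}
      ≤ ENNReal.ofReal (Real.exp (-d)) := by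
  refine (measure_mono ?_).trans (net_apply hd (E := Fin d → ℝ) ?_
    (LinearMap.pi fun _ => LinearMap.id) K hK0 hK)
  · rintro v ⟨x, hx⟩
    exact ⟨x, ∑ b, x b ^ 2, Finset.sum_nonneg fun _ _ => sq_nonneg _, fun i => le_rfl, hx⟩
  · simp only [Module.finrank_fintype_fun_eq_card, Fintype.card_fin]; nlinarith

lemma f4_prob {n d : ℕ} (hd : 0 < d) (K : ℝ) (hK0 : 0 ≤ K) (hK : 3 * (d : ℝ) ^ 2 ≤ n * (K / 4 - 1))
    (u : Fin n → Fin d → ℝ) :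
    PV n d {v | ∃ (W : Matrix (Fin d) (Fin d) ℝ) (R : ℝ), 0 ≤ R ∧
        (∀ i, ∑ b, (∑ a, u i a * W a b) ^ 2 ≤ R) ∧
        4 * K * (n / d) * R < ∑ i, (∑ b, (∑ a, u i a * W a b) * v i b) ^ 2}
      ≤ ENNReal.ofReal (Real.exp (-d)) := by
  let L : Matrix (Fin d) (Fin d) ℝ →ₗ[ℝ] (Fin n → Fin d → ℝ) :=
    { toFun := fun W i b => ∑ a, u i a * W a b
      map_add' := by
        intro W W'; ext i b; simp [mul_add, Finset.sum_add_distrib]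
      map_smul' := by
        intro c W; ext i b; simp [Finset.mul_sum]; exact Finset.sum_congr rfl fun _ _ => by ring }
  exact net_apply hd (E := Matrix (Fin d) (Fin d) ℝ)
    (by simp [Module.finrank_matrix, sq]) L K hK0 hK

lemma exp_le_q {d : ℕ} : ENNReal.ofReal (Real.exp (-(d : ℝ))) ≤ ENNReal.ofReal (Real.exp (-((d : ℝ) / 4))) := by
  apply ENNReal.ofReal_le_ofReal; apply Real.exp_le_exp.2
  have : (0 : ℝ) ≤ d := by positivity
  linarith

lemma gu_det {n d : ℕ} (hd : 0 < d) (hn2 : 2 ≤ n) (hnd : 64 * d ≤ n) (K : ℝ) (hK0 : 0 ≤ K)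
    (u : Fin n → Fin d → ℝ)
    (h1 : ∀ x : Fin d → ℝ, ∑ i, (∑ b, x b * u i b) ^ 2 ≤ 4 * K * (n / d) * (∑ b, x b ^ 2))
    (h2 : ∀ i, ∑ b, u i b ^ 2 ≤ 8) (h3 : ∑ b, (∑ i, u i b) ^ 2 ≤ 8 * n)
    (h4 : ∀ a, (n : ℝ) / (4 * d) ≤ ∑ i, u i a ^ 2) : GU K u := by
  have hd' : (0 : ℝ) < d := by exact_mod_cast hd
  have hn' : (2 : ℝ) ≤ n := by exact_mod_cast hn2
  have hnd' : (64 : ℝ) * d ≤ n := by exact_mod_cast hnd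
  refine ⟨fun a => ?_, fun a => ?_, fun i => ?_⟩
  · refine le_trans ?_ (centre_lower hn2 fun i => u i a)
    have e1 : (∑ i, u i a) ^ 2 ≤ 8 * n :=
      (Finset.single_le_sum (f := fun b => (∑ i, u i b) ^ 2) (fun _ _ => sq_nonneg _)
        (Finset.mem_univ a)).trans h3
    have e2 : (∑ i, u i a) ^ 2 / n ≤ 8 := by rw [div_le_iff₀ (by linarith)]; exact e1
    have e3 : (8 : ℝ) ≤ n / (8 * d) := by rw [le_div_iff₀ (by linarith)]; linarith
    have e4 : (n : ℝ) / (4 * d) = n / (8 * d) + n / (8 * d) := by field_simp; norm_num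
    have := h4 a
    linarith
  · refine (centre_upper hn2 fun i => u i a).trans ?_
    have := h1 (Pi.single a 1)
    simp [Pi.single_apply] at this
    linarith
  · have key : ∀ j, (∑ a, cen u j a * u i a) = (∑ a, u i a * u j a) - ((n : ℝ) - 1)⁻¹ *
        ∑ l ∈ Finset.univ.erase j, ∑ a, u i a * u l a := by
      intro j
      rw [Finset.sum_comm, Finset.mul_sum, ← Finset.sum_sub_distrib]
      refine Finset.sum_congr rfl fun a _ => ?_
      rw [cen, ← Finset.mul_sum]; ring
    simp_rw [key]
    refine (centre_upper hn2 fun j => ∑ a, u i a * u j a).trans ?_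
    have e1 := h1 (u i)
    have e2 : 4 * K * (n / d) * (∑ b, u i b ^ 2) ≤ 4 * K * (n / d) * 8 :=
      mul_le_mul_of_nonneg_left (h2 i) (by positivity)
    linarith

lemma gu_prob {n d : ℕ} (hd : 0 < d) (hn2 : 2 ≤ n) (hnd : 64 * d ≤ n) (K : ℝ) (hK0 : 0 ≤ K)
    (hK : 3 * (d : ℝ) ^ 2 ≤ n * (K / 4 - 1)) :
    PV n d {u | ¬ GU K u} ≤ (2 + n + d) * ENNReal.ofReal (Real.exp (-((d : ℝ) / 4))) := by
  set ε := ENNReal.ofReal (Real.exp (-((d : ℝ) / 4))) with hε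
  have a1 := (e1_prob hd K hK0 hK).trans exp_le_q
  have a2 := measure_exists_le (PV n d)
    (fun i : Fin n => {v | 8 * ∑ j, (Pi.single i (1 : ℝ) : Fin n → ℝ) j ^ 2 < ∑ b, (∑ j, (Pi.single i (1 : ℝ) : Fin n → ℝ) j * v j b) ^ 2}) ε
    (fun i => (col_upper hd _).trans exp_le_q)
  have a3 := (col_upper (n := n) hd (fun _ => 1)).trans exp_le_q
  have a4 := measure_exists_le (PV n d)
    (fun a : Fin d => {v | ∑ i, (∑ b, (Pi.single a (1 : ℝ) : Fin d → ℝ) b * v i b) ^ 2 ≤ n / (4 * d)}) ε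
    (fun a => (row_lower hd _ (by simp [Pi.single_apply])).trans (by
      apply ENNReal.ofReal_le_ofReal; apply Real.exp_le_exp.2
      have : (d : ℝ) ≤ n := by exact_mod_cast (by lia : d ≤ n)
      linarith))
  simp only [Fintype.card_fin] at a2 a4
  refine (measure_union4 a1 a2 a3 a4 ?_).trans (le_of_eq (by ring))
  intro u c1 c2 c3 c4 hu
  refine hu (gu_det hd hn2 hnd K hK0 u ?_ ?_ ?_ ?_)
  · exact fun x => le_of_not_gt fun h => c1 ⟨x, h⟩
  · intro i
    refine le_of_not_gt fun h => c2 ⟨i, ?_⟩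
    simpa [Pi.single_apply] using h
  · refine le_of_not_gt fun h => c3 ?_
    simpa using h
  · intro a
    refine le_of_not_gt fun h => c4 ⟨a, ?_⟩
    simpa [Pi.single_apply] using h.le

lemma gm_row {n d : ℕ} (u v : Fin n → Fin d → ℝ) (a b : Fin d) :
    Gm u v a b = ∑ i, cen u i a * v i b := rfl

lemma sc_eq {n d : ℕ} (u v : Fin n → Fin d → ℝ) (W : Matrix (Fin d) (Fin d) ℝ) (j i : Fin n) :
    sc u v W j i = ∑ b, (∑ a, u j a * W a b) * v i b := by
  simp only [sc, dotProduct, mulVec, Finset.mul_sum, Finset.sum_mul]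
  rw [Finset.sum_comm]
  exact Finset.sum_congr rfl fun _ _ => Finset.sum_congr rfl fun _ _ => by ring

lemma gtu_eq {n d : ℕ} (u v : Fin n → Fin d → ℝ) (i : Fin n) (b : Fin d) :
    ∑ a, u i a * Gm u v a b = ∑ j, (∑ a, cen u j a * u i a) * v j b := by
  simp only [gm_row, Finset.mul_sum, Finset.sum_mul]
  rw [Finset.sum_comm]
  exact Finset.sum_congr rfl fun _ _ => Finset.sum_congr rfl fun _ _ => by ring

lemma gv_det {n d : ℕ} (hd : 0 < d) (K : ℝ) (hK0 : 0 ≤ K)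
    (u v : Fin n → Fin d → ℝ) (hu : GU K u)
    (h1 : ∀ x : Fin d → ℝ, ∑ i, (∑ b, x b * v i b) ^ 2 ≤ 4 * K * (n / d) * (∑ b, x b ^ 2))
    (h2 : ∀ a, (∑ i, cen u i a ^ 2) / 4 ≤ ∑ b, (∑ i, cen u i a * v i b) ^ 2)
    (h2' : ∀ a, ∑ b, (∑ i, cen u i a * v i b) ^ 2 ≤ 8 * (∑ i, cen u i a ^ 2))
    (h3 : ∀ i, ∑ b, (∑ j, (∑ a, cen u j a * u i a) * v j b) ^ 2 ≤
      8 * ∑ j, (∑ a, cen u j a * u i a) ^ 2)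
    (h4 : ∀ (W : Matrix (Fin d) (Fin d) ℝ) (R : ℝ), 0 ≤ R →
        (∀ i, ∑ b, (∑ a, u i a * W a b) ^ 2 ≤ R) →
        ∑ i, (∑ b, (∑ a, u i a * W a b) * v i b) ^ 2 ≤ 4 * K * (n / d) * R) : GV K u v := by
  have hd' : (0 : ℝ) < d := by exact_mod_cast hd
  obtain ⟨g1, g2, g3⟩ := hu
  have hR : ∀ i, ∑ b, (∑ a, u i a * Gm u v a b) ^ 2 ≤ 1024 * K * (n / d) := by
    intro i
    simp_rw [gtu_eq]
    linarith [h3 i, g3 i]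
  refine ⟨?_, ?_, ?_, ?_⟩
  · calc (n : ℝ) / 32 = ∑ a : Fin d, (n : ℝ) / (32 * d) := by
          simp; field_simp
      _ ≤ _ := Finset.sum_le_sum fun a _ => by
          have : (n : ℝ) / (32 * d) = n / (8 * d) / 4 := by rw [div_div]; congr 1; ring
          have := g1 a
          have := h2 a
          simp only [gm_row]
          linarith
  · calc _ ≤ ∑ a : Fin d, 128 * K * ((n : ℝ) / d) := Finset.sum_le_sum fun a _ => by
          have := g2 a
          have := h2' a
          simp only [gm_row]
          linarith
      _ = _ := by simp; field_simp
  · simp_rw [sc_eq]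
    refine (h4 (Gm u v) (1024 * K * (n / d)) (by positivity) hR).trans (le_of_eq (by ring))
  · calc _ ≤ ∑ j : Fin n, 4096 * K ^ 2 * ((n : ℝ) / d) ^ 2 := Finset.sum_le_sum fun j _ => by
          simp_rw [sc_eq]
          refine (h1 _).trans ?_
          refine (mul_le_mul_of_nonneg_left (hR j) (by positivity)).trans (le_of_eq (by ring))
      _ = _ := by simp; ring

lemma gv_prob {n d : ℕ} (hd : 0 < d) (hn : 0 < n) (K : ℝ) (hK0 : 0 ≤ K)
    (hK : 3 * (d : ℝ) ^ 2 ≤ n * (K / 4 - 1)) (u : Fin n → Fin d → ℝ) (hu : GU K u) :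
    PV n d {v | ¬ GV K u v} ≤ (2 + n + 2 * d) * ENNReal.ofReal (Real.exp (-((d : ℝ) / 4))) := by
  set ε := ENNReal.ofReal (Real.exp (-((d : ℝ) / 4))) with hε
  have hd' : (0 : ℝ) < d := by exact_mod_cast hd
  have hn' : (0 : ℝ) < n := by exact_mod_cast hn
  have a1 := (e1_prob hd K hK0 hK).trans exp_le_q
  have a4 := (f4_prob hd K hK0 hK u).trans exp_le_q
  have a2 := measure_exists_le (PV n d) _ ε
    (fun a : Fin d => (col_lower hd (fun i => cen u i a)
      (lt_of_lt_of_le (by positivity) (hu.1 a))))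
  have a2' := measure_exists_le (PV n d) _ ε
    (fun a : Fin d => (col_upper hd (fun i => cen u i a)).trans exp_le_q)
  have a3 := measure_exists_le (PV n d) _ ε
    (fun i : Fin n => (col_upper hd (fun j => ∑ a, cen u j a * u i a)).trans exp_le_q)
  simp only [Fintype.card_fin] at a2 a2' a3
  refine (measure_union4 a1 a4 a3 ((measure_union_le _ _).trans (add_le_add a2 a2')) ?_).trans
    (le_of_eq (by ring))
  intro v c1 c4 c3 c2 hv
  simp only [Set.mem_union, not_or] at c2
  refine hv (gv_det hd K hK0 u v hu ?_ ?_ ?_ ?_ ?_)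
  · exact fun x => le_of_not_gt fun h => c1 ⟨x, h⟩
  · exact fun a => le_of_not_gt fun h => c2.1 ⟨a, h.le⟩
  · exact fun a => le_of_not_gt fun h => c2.2 ⟨a, h⟩
  · exact fun i => le_of_not_gt fun h => c3 ⟨i, h⟩
  · exact fun W R h0 hR => le_of_not_gt fun h => c4 ⟨W, R, h0, hR, h⟩

lemma gu_meas (K : ℝ) {n d : ℕ} : MeasurableSet {u : Fin n → Fin d → ℝ | GU K u} := by
  unfold GU cen
  measurability

lemma gv_meas (K : ℝ) {n d : ℕ} :
    MeasurableSet {p : (Fin n → Fin d → ℝ) × (Fin n → Fin d → ℝ) | GV K p.1 p.2} := by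
  unfold GV
  simp only [sc_eq, gm_row, cen]
  have m1 : Measurable (fun p : (Fin n → Fin d → ℝ) × (Fin n → Fin d → ℝ) =>
      ∑ a : Fin d, ∑ b : Fin d, (∑ i, (p.1 i a - ((n : ℝ) - 1)⁻¹ *
        ∑ j ∈ Finset.univ.erase i, p.1 j a) * p.2 i b) ^ 2) := by fun_prop
  have m2 : ∀ j i, Measurable (fun p : (Fin n → Fin d → ℝ) × (Fin n → Fin d → ℝ) =>
      (∑ b, (∑ a, p.1 j a * ∑ i, (p.1 i a - ((n : ℝ) - 1)⁻¹ *
        ∑ j ∈ Finset.univ.erase i, p.1 j a) * p.2 i b) * p.2 i b) ^ 2) := by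
    intro j i; fun_prop
  have m3 := Finset.measurable_sum Finset.univ fun i _ => m2 i i
  have m4 := Finset.measurable_sum Finset.univ fun j _ =>
    Finset.measurable_sum Finset.univ fun i _ => m2 j i
  exact (measurableSet_le measurable_const m1).inter ((measurableSet_le m1 measurable_const).inter
    ((measurableSet_le m3 measurable_const).inter (measurableSet_le m4 measurable_const)))

lemma gv_joint {n d : ℕ} (hd : 0 < d) (hn2 : 2 ≤ n) (hnd : 64 * d ≤ n) (K : ℝ) (hK0 : 0 ≤ K)
    (hK : 3 * (d : ℝ) ^ 2 ≤ n * (K / 4 - 1)) :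
    ENNReal.ofReal (1 - 10 * n * Real.exp (-((d : ℝ) / 4))) ≤
      gaussianModel d n {p | GV K p.1 p.2} := by
  set ε := ENNReal.ofReal (Real.exp (-((d : ℝ) / 4))) with hε
  have hbad : gaussianModel d n {p | ¬ GV K p.1 p.2} ≤
      (2 + n + d) * ε + (2 + n + 2 * d) * ε := by
    change ((PV n d).prod (PV n d)) _ ≤ _
    have hms : MeasurableSet {p : (Fin n → Fin d → ℝ) × (Fin n → Fin d → ℝ) | ¬ GV K p.1 p.2} :=
      (gv_meas K).compl
    rw [Measure.prod_apply hms]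
    have hm := (gu_meas K (n := n) (d := d)).compl
    calc _ ≤ ∫⁻ u, (Set.indicator {u | ¬ GU K u} (fun _ => 1) u + (2 + n + 2 * d) * ε) ∂(PV n d) := by
          refine lintegral_mono fun u => ?_
          by_cases hu : GU K u
          · exact (gv_prob hd (by lia) K hK0 hK u hu).trans le_add_self
          · have : u ∈ {u | ¬ GU K u} := hu
            simp only [Set.indicator_of_mem this]
            exact prob_le_one.trans le_self_add
      _ = PV n d {u | ¬ GU K u} + (2 + n + 2 * d) * ε := by
          rw [lintegral_add_right _ measurable_const]
          congr 1
          · exact (lintegral_indicator_one hm)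
          · simp
      _ ≤ _ := add_le_add_left (gu_prob hd hn2 hnd K hK0 hK) _
  have : IsProbabilityMeasure (gaussianModel d n) := by unfold gaussianModel; infer_instance
  have hc : gaussianModel d n {p | ¬ GV K p.1 p.2} ≤
      ENNReal.ofReal (10 * n * Real.exp (-((d : ℝ) / 4))) := by
    refine hbad.trans ?_
    rw [ENNReal.ofReal_mul (by positivity), ← hε, ← add_mul]
    gcongr
    rw [show (10 * n : ℝ) = ((10 * n : ℕ) : ℝ) by push_cast; ring, ENNReal.ofReal_natCast]
    exact_mod_cast (by lia : 2 + n + d + (2 + n + 2 * d) ≤ 10 * n)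
  have he := prob_add_prob_compl (μ := gaussianModel d n) (gv_meas K (n := n) (d := d))
  rw [ENNReal.ofReal_sub _ (by positivity), ENNReal.ofReal_one, tsub_le_iff_right, ← he]
  exact add_le_add_right hc _

lemma gv_target {n d k : ℕ} (α r β lam K : ℝ) (hα : 0 < α) (hr0 : 0 < r) (hβ : 0 < β) (hlam : 0 < lam)
    (hK : 0 < K) (hd : 0 < d) (hn2 : 2 ≤ n) (hlo : α / 2 * (d : ℝ) ^ 2 ≤ n)
    (hhi : (n : ℝ) ≤ 2 * α * (d : ℝ) ^ 2) (hk : r * n / 2 ≤ k) (hk0 : 0 < k) (hkn : k + 1 < n)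
    (u v : Fin n → Fin d → ℝ) (hg : GV K u v)
    (W : Matrix (Fin d) (Fin d) ℝ) (μ : Fin n → ℝ)
    (hmin : ∀ (W' : Matrix (Fin d) (Fin d) ℝ) (μ' : Fin n → ℝ),
      tamObjective u v k β lam W μ ≤ tamObjective u v k β lam W' μ') :
    (α / 64) ^ 2 / (16 * (2 * α * (3 * (8192 * α * K ^ 2) + β * (8192 * α * K ^ 2) / r
      + 128 * lam * α * K)) * √(256 * K * α)) ≤ √(∑ a, ∑ b, W a b ^ 2) / d := by
  have hd' : (0 : ℝ) < d := by exact_mod_cast hd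
  have hn' : (2 : ℝ) ≤ n := by exact_mod_cast hn2
  have hk' : (0 : ℝ) < k := by exact_mod_cast hk0
  obtain ⟨g1, g2, g3, g4⟩ := hg
  set B := 8192 * α * K ^ 2 with hB
  have hBpos : 0 < B := by positivity
  have hM : 4096 * K ^ 2 * ((n : ℝ) / d) ^ 2 ≤ B * n := by
    have : ((n : ℝ) / d) ^ 2 ≤ 2 * α * n := by
      rw [div_pow, div_le_iff₀ (by positivity)]
      nlinarith
    calc _ ≤ 4096 * K ^ 2 * (2 * α * n) := by gcongr
      _ = _ := by rw [hB]; ring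
  have hA : ∑ i, sc u v (Gm u v) i i ^ 2 ≤ B * n := g3.trans hM
  have hT0 : ∑ j, ∑ i, sc u v (Gm u v) j i ^ 2 ≤ B * n * n :=
    g4.trans (mul_le_mul_of_nonneg_right hM (by linarith))
  have hT : ∑ i, ∑ j ∈ Finset.univ.erase i, sc u v (Gm u v) j i ^ 2 ≤ B * n * n := by
    refine le_trans ?_ hT0
    rw [Finset.sum_comm (γ := Fin n) (s := Finset.univ) (t := Finset.univ)]
    refine Finset.sum_le_sum fun i _ => ?_
    exact Finset.sum_le_sum_of_subset_of_nonneg (Finset.erase_subset _ _) fun _ _ _ => sq_nonneg _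
  have hT00 : 0 ≤ ∑ i, ∑ j ∈ Finset.univ.erase i, sc u v (Gm u v) j i ^ 2 :=
    Finset.sum_nonneg fun _ _ => Finset.sum_nonneg fun _ _ => sq_nonneg _
  have hinv : ((n : ℝ) - 1)⁻¹ ≤ 2 / n := by
    rw [inv_eq_one_div, div_le_div_iff₀ (by linarith) (by linarith)]; linarith
  have hdl : ∑ i, dl u v (Gm u v) i ^ 2 ≤ 6 * B * n := by
    have e1 : ∀ i, dl u v (Gm u v) i ^ 2 ≤ 2 * sc u v (Gm u v) i i ^ 2 +
        2 * (((n : ℝ) - 1)⁻¹ * ∑ j ∈ Finset.univ.erase i, sc u v (Gm u v) j i ^ 2) := by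
      intro i
      have cs := sq_sum_le_card_mul_sum_sq (s := Finset.univ.erase i)
        (f := fun j => sc u v (Gm u v) j i)
      have hc : ((Finset.univ.erase i).card : ℝ) = n - 1 := by
        rw [Finset.card_erase_of_mem (Finset.mem_univ i)]
        simp [Nat.cast_sub (show 1 ≤ n by lia)]
      rw [hc] at cs
      have : (((n : ℝ) - 1)⁻¹ * ∑ j ∈ Finset.univ.erase i, sc u v (Gm u v) j i) ^ 2 ≤
          ((n : ℝ) - 1)⁻¹ * ∑ j ∈ Finset.univ.erase i, sc u v (Gm u v) j i ^ 2 := by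
        rw [mul_pow]
        calc _ ≤ ((n : ℝ) - 1)⁻¹ ^ 2 * _ := mul_le_mul_of_nonneg_left cs (sq_nonneg _)
          _ = _ := by
            have : (n : ℝ) - 1 ≠ 0 := by linarith
            field_simp
      rw [dl]
      nlinarith [sq_nonneg (sc u v (Gm u v) i i +
        ((n : ℝ) - 1)⁻¹ * ∑ j ∈ Finset.univ.erase i, sc u v (Gm u v) j i)]
    refine (Finset.sum_le_sum fun i _ => e1 i).trans ?_
    rw [Finset.sum_add_distrib, ← Finset.mul_sum, ← Finset.mul_sum, ← Finset.mul_sum]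
    have : ((n : ℝ) - 1)⁻¹ * ∑ i, ∑ j ∈ Finset.univ.erase i, sc u v (Gm u v) j i ^ 2 ≤
        2 / n * (B * n * n) := mul_le_mul hinv hT hT00 (by positivity)
    have e3 : 2 / (n : ℝ) * (B * n * n) = 2 * B * n := by field_simp
    linarith
  have hGn : 0 ≤ ∑ a, ∑ b, Gm u v a b ^ 2 :=
    Finset.sum_nonneg fun _ _ => Finset.sum_nonneg fun _ _ => sq_nonneg _
  refine det_bound u v β lam hβ hlam hd hk0 hkn (α / 64) _ (256 * K * α) (by positivity)
    (by positivity) (by positivity) ?_ ?_ ?_ W μ hmin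
  · linarith
  · nlinarith
  · have t2 : β / (2 * k) * (∑ i, ∑ j ∈ Finset.univ.erase i, sc u v (Gm u v) j i ^ 2) ≤
        β * B / r * n := by
      have : β / (2 * k) ≤ β / (r * n) := by
        apply div_le_div_of_nonneg_left hβ.le (by positivity); linarith
      calc _ ≤ β / (r * n) * (B * n * n) := mul_le_mul this hT hT00 (by positivity)
        _ = _ := by field_simp
    have t3 : lam * n / (2 * (d : ℝ) ^ 2) * ∑ a, ∑ b, Gm u v a b ^ 2 ≤ 128 * lam * α * K * n := by
      have : lam * n / (2 * (d : ℝ) ^ 2) ≤ lam * α := by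
        rw [div_le_iff₀ (by positivity)]; nlinarith
      calc _ ≤ lam * α * (128 * K * n) := mul_le_mul this g2 hGn (by positivity)
        _ = _ := by ring
    have t4 : (3 * B + β * B / r + 128 * lam * α * K) * n ≤
        (3 * B + β * B / r + 128 * lam * α * K) * (2 * α * (d : ℝ) ^ 2) :=
      mul_le_mul_of_nonneg_left hhi (by positivity)
    linarith

lemma decay_ev (D c : ℝ) : ∀ᶠ x : ℝ in atTop,
    c * x ^ 2 * Real.exp (-(x / 4)) ≤ x ^ (-D) := by
  have h := (tendsto_rpow_mul_exp_neg_mul_atTop_nhds_zero (D + 2) (1 / 4) (by norm_num)).const_mul c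
  rw [mul_zero] at h
  filter_upwards [h.eventually (eventually_le_nhds (zero_lt_one)), eventually_gt_atTop 0] with x hx h0
  rw [Real.rpow_add h0] at hx
  have e : (x : ℝ) ^ (2 : ℝ) = x ^ 2 := by norm_cast
  rw [e] at hx
  rw [Real.rpow_neg h0.le, ← one_div, le_div_iff₀ (Real.rpow_pos_of_pos h0 D)]
  refine le_trans (le_of_eq ?_) hx
  rw [show -(x / 4) = -(1 / 4) * x by ring]; ring

/-- **High-probability lower bound on the TAM minimizer's Frobenius norm.** Fix
`r ∈ (0,1)`, `α ∈ (0,∞)`, `β > 0`, `λ > 0`, and a sequence `n, d → ∞` with `n/d² → α`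
and `k = ⌈r(n−1)⌉`. Then there exists `c₀ > 0` (depending only on `(α, r, β, λ)`)
such that for every `D > 0` there is `d₀` with: for all indices `m` with `d_m ≥ d₀`,
with probability at least `1 − d_m^{−D}` every global minimizer `(W, μ)` of the TAM
objective satisfies `‖W‖_F/d ≥ c₀`. -/
theorem tam_frobenius_lower_bound (r α β lam : ℝ) (hr0 : 0 < r) (hr1 : r < 1)
    (hα : 0 < α) (hβ : 0 < β) (hlam : 0 < lam)
    (n d : ℕ → ℕ) (hn : Tendsto n atTop atTop) (hd : Tendsto d atTop atTop)
    (hlim : Tendsto (fun m => (n m : ℝ) / (d m : ℝ) ^ 2) atTop (𝓝 α)) :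
    ∃ c₀ : ℝ, 0 < c₀ ∧ ∀ D : ℝ, 0 < D → ∃ d₀ : ℕ, ∀ m : ℕ, d₀ ≤ d m →
      ENNReal.ofReal (1 - (d m : ℝ) ^ (-D)) ≤
        gaussianModel (d m) (n m)
          {p | ∀ (W : Matrix (Fin (d m)) (Fin (d m)) ℝ) (μ : Fin (n m) → ℝ),
            (∀ (W' : Matrix (Fin (d m)) (Fin (d m)) ℝ) (μ' : Fin (n m) → ℝ),
              tamObjective p.1 p.2 ⌈r * ((n m : ℝ) - 1)⌉₊ β lam W μ ≤
                tamObjective p.1 p.2 ⌈r * ((n m : ℝ) - 1)⌉₊ β lam W' μ') →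
            c₀ ≤ Real.sqrt (∑ a, ∑ b, W a b ^ 2) / (d m : ℝ)} := by
  set K : ℝ := 4 + 24 / α with hKdef
  have hK : 0 < K := by positivity
  refine ⟨(α / 64) ^ 2 / (16 * (2 * α * (3 * (8192 * α * K ^ 2) + β * (8192 * α * K ^ 2) / r
      + 128 * lam * α * K)) * √(256 * K * α)), by positivity, fun D _ => ?_⟩
  have hdR : Tendsto (fun m => (d m : ℝ)) atTop atTop := tendsto_natCast_atTop_atTop.comp hd
  have hnR : Tendsto (fun m => (n m : ℝ)) atTop atTop := tendsto_natCast_atTop_atTop.comp hn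
  have hr : 0 < 1 - r := by linarith
  have hev : ∀ᶠ m in atTop,
      ENNReal.ofReal (1 - (d m : ℝ) ^ (-D)) ≤
        gaussianModel (d m) (n m)
          {p | ∀ (W : Matrix (Fin (d m)) (Fin (d m)) ℝ) (μ : Fin (n m) → ℝ),
            (∀ (W' : Matrix (Fin (d m)) (Fin (d m)) ℝ) (μ' : Fin (n m) → ℝ),
              tamObjective p.1 p.2 ⌈r * ((n m : ℝ) - 1)⌉₊ β lam W μ ≤
                tamObjective p.1 p.2 ⌈r * ((n m : ℝ) - 1)⌉₊ β lam W' μ') →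
            (α / 64) ^ 2 / (16 * (2 * α * (3 * (8192 * α * K ^ 2) + β * (8192 * α * K ^ 2) / r
              + 128 * lam * α * K)) * √(256 * K * α)) ≤
              Real.sqrt (∑ a, ∑ b, W a b ^ 2) / (d m : ℝ)} := by
    filter_upwards [hlim.eventually (eventually_ge_nhds (show α / 2 < α by linarith)),
      hlim.eventually (eventually_le_nhds (show α < 2 * α by linarith)),
      hdR.eventually (eventually_ge_atTop (128 / α)), hdR.eventually (eventually_ge_atTop 1),
      hnR.eventually (eventually_ge_atTop 2),
      hnR.eventually (eventually_ge_atTop (1 + 1 / (1 - r))),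
      hdR.eventually (decay_ev D (20 * α))] with m h1 h2 h3 h4 h5 h6 h7
    have hd0 : 0 < d m := by exact_mod_cast (by linarith : (0 : ℝ) < d m)
    have hn2 : 2 ≤ n m := by exact_mod_cast h5
    have hdp : (0 : ℝ) < d m := by linarith
    rw [le_div_iff₀ (by positivity)] at h1
    rw [div_le_iff₀ (by positivity)] at h2
    have hnd : 64 * d m ≤ n m := by
      have : (64 : ℝ) * d m ≤ n m := by
        rw [div_le_iff₀ hα] at h3
        nlinarith
      exact_mod_cast this
    have hK3 : 3 * (d m : ℝ) ^ 2 ≤ n m * (K / 4 - 1) := by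
      have : K / 4 - 1 = 6 / α := by rw [hKdef]; ring
      rw [this, ← mul_div_assoc, le_div_iff₀ hα]; linarith
    have hk1 : r * ((n m : ℝ) - 1) ≤ ⌈r * ((n m : ℝ) - 1)⌉₊ := Nat.le_ceil _
    have hpos : 0 < r * ((n m : ℝ) - 1) := mul_pos hr0 (by linarith)
    have hk0 : 0 < ⌈r * ((n m : ℝ) - 1)⌉₊ := Nat.ceil_pos.2 hpos
    have hk2 := Nat.ceil_lt_add_one hpos.le
    have hkn : ⌈r * ((n m : ℝ) - 1)⌉₊ + 1 < n m := by
      have e : 1 ≤ (1 - r) * ((n m : ℝ) - 1) := by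
        have : 1 / (1 - r) ≤ (n m : ℝ) - 1 := by linarith
        rw [div_le_iff₀ hr] at this; linarith
      have : ((⌈r * ((n m : ℝ) - 1)⌉₊ : ℝ)) + 1 < n m := by linarith
      exact_mod_cast this
    have hkr : r * n m / 2 ≤ (⌈r * ((n m : ℝ) - 1)⌉₊ : ℝ) := by nlinarith
    refine le_trans ?_ ((gv_joint hd0 hn2 hnd K hK.le hK3).trans (measure_mono ?_))
    · apply ENNReal.ofReal_le_ofReal
      have : 10 * (n m : ℝ) * Real.exp (-((d m : ℝ) / 4)) ≤
          20 * α * (d m : ℝ) ^ 2 * Real.exp (-((d m : ℝ) / 4)) := by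
        apply mul_le_mul_of_nonneg_right _ (Real.exp_pos _).le
        linarith
      linarith
    · intro p hp W μ hmin
      exact gv_target α r β lam K hα hr0 hβ hlam hK hd0 hn2 h1 h2 hkr hk0 hkn p.1 p.2 hp W μ hmin
  obtain ⟨M, hM⟩ := eventually_atTop.1 hev
  refine ⟨(Finset.range M).sup d + 1, fun m hm => hM m ?_⟩
  by_contra hlt
  have : d m ≤ (Finset.range M).sup d := Finset.le_sup (Finset.mem_range.2 (by lia))
  lia

end
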